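/- Let ε < 1/2 and δ > 0 satisfy 2ε + 3δ = 1. Then there exist a continuous complex-valued function q on ℝ² satisfying q(x) = O(|x|^{−ε}) as |x| → ∞, and a C² complex-valued function u on ℝ² which does not have compact support, such that Δu − q·u = 0 on ℝ² and u(x) = O(exp(−β|x|^{1+δ})) as |x| → ∞ for some β > 0. -/

import Mathlib

open MeasureTheory Real

/-- The Laplacian of a complex-valued function on `ℝ²`. -/
noncomputable def laplacian (u : EuclideanSpace ℝ (Fin 2) → ℂ)
    (x : EuclideanSpace ℝ (Fin 2)) : ℂ :=
  ∑ i : Fin 2, fderiv ℝ (fun y => fderiv ℝ u y (EuclideanSpace.single i 1)) x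
    (EuclideanSpace.single i 1)

namespace Meshkov

/-- The Laplacian of a function on the complex plane. -/
noncomputable def lap (f : ℂ → ℂ) (w : ℂ) : ℂ :=
  fderiv ℝ (fderiv ℝ f) w 1 1 + fderiv ℝ (fderiv ℝ f) w Complex.I Complex.I

lemma lap_congr {f g : ℂ → ℂ} {w : ℂ} (h : f =ᶠ[nhds w] g) : lap f w = lap g w := by
  unfold lap
  rw [h.fderiv.fderiv_eq]

lemma differentiableAt_fderiv {E F : Type*} [NormedAddCommGroup E] [NormedSpace ℝ E]
    [NormedAddCommGroup F] [NormedSpace ℝ F] {f : E → F} {w : E} (hf : ContDiffAt ℝ 2 f w) :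
    DifferentiableAt ℝ (fderiv ℝ f) w :=
  (hf.fderiv_right (m := 1) (by norm_num)).differentiableAt (by norm_num)

lemma lap_sub {f g : ℂ → ℂ} (hf : ContDiff ℝ 2 f) (hg : ContDiff ℝ 2 g) (w : ℂ) :
    lap (fun z => f z - g z) w = lap f w - lap g w := by
  have h1 : fderiv ℝ (fun z => f z - g z) = fun z => fderiv ℝ f z - fderiv ℝ g z := by
    ext1 z
    exact fderiv_fun_sub (hf.differentiable (by norm_num) z) (hg.differentiable (by norm_num) z)
  unfold lap
  rw [h1, fderiv_fun_sub (differentiableAt_fderiv hf.contDiffAt)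
    (differentiableAt_fderiv hg.contDiffAt)]
  simp only [sub_apply]
  ring

lemma lap_const_mul {f : ℂ → ℂ} (hf : ContDiff ℝ 2 f) (c w : ℂ) :
    lap (fun z => c * f z) w = c * lap f w := by
  have h1 : fderiv ℝ (fun z => c * f z) = fun z => c • fderiv ℝ f z := by
    ext1 z
    exact fderiv_const_mul (hf.differentiable (by norm_num) z) c
  unfold lap
  rw [h1, fderiv_fun_const_smul (differentiableAt_fderiv hf.contDiffAt) c]
  simp only [smul_apply, smul_eq_mul]
  ring

/-- The second directional derivative, computed along a line. -/
lemma fderiv_fderiv_apply_eq {f f' : ℂ → ℂ} {f'' v w : ℂ} (hf : ContDiff ℝ 2 f)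
    (h1 : ∀ t : ℝ, HasDerivAt (fun t : ℝ => f (w + t * v)) (f' (w + t * v)) t)
    (h2 : HasDerivAt (fun t : ℝ => f' (w + t * v)) f'' 0) :
    fderiv ℝ (fderiv ℝ f) w v v = f'' := by
  have hl : ∀ t : ℝ, HasDerivAt (fun t : ℝ => w + t * v) v t := fun t => by
    simpa using ((Complex.ofRealCLM.hasDerivAt (x := t)).mul_const v).const_add w
  have e1 : ∀ t : ℝ, f' (w + t * v) = fderiv ℝ f (w + t * v) v := fun t =>
    (h1 t).unique
      (((hf.differentiable (by norm_num) (w + t * v)).hasFDerivAt).comp_hasDerivAt t (hl t))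
  have h3 : HasFDerivAt (fderiv ℝ f) (fderiv ℝ (fderiv ℝ f) w) (w + (0 : ℝ) * v) := by
    have h0 : w + ((0 : ℝ) : ℂ) * v = w := by simp
    rw [h0]
    exact (differentiableAt_fderiv (w := w) hf.contDiffAt).hasFDerivAt
  have h4 : HasDerivAt (fun t : ℝ => fderiv ℝ f (w + t * v)) (fderiv ℝ (fderiv ℝ f) w v) 0 :=
    h3.comp_hasDerivAt (0 : ℝ) (hl 0)
  have h5 : HasDerivAt (fun t : ℝ => fderiv ℝ f (w + t * v) v)
      (fderiv ℝ (fderiv ℝ f) w v v) 0 := by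
    have := h4.clm_apply (hasDerivAt_const (0 : ℝ) v)
    rwa [map_zero, add_zero] at this
  exact h5.unique (h2.congr_of_eventuallyEq (Filter.Eventually.of_forall fun t => (e1 t).symm))

lemma lap_comp_exp {f : ℂ → ℂ} {w : ℂ} (hf : ContDiffAt ℝ 2 f (Complex.exp w)) :
    lap (fun z => f (Complex.exp z)) w = (‖Complex.exp w‖ : ℂ) ^ 2 * lap f (Complex.exp w) := by
  have hexp : ∀ z, HasFDerivAt Complex.exp
      ((Complex.exp z) • (ContinuousLinearMap.id ℝ ℂ)) z := fun z =>
    (Complex.hasStrictFDerivAt_exp_real z).hasFDerivAt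
  have hev : ∀ᶠ z in nhds w, DifferentiableAt ℝ f (Complex.exp z) := by
    have := hf.eventually (by simp)
    filter_upwards [Complex.continuous_exp.continuousAt.eventually this] with z hz
    exact hz.differentiableAt (by norm_num)
  have h1 : fderiv ℝ (fun z => f (Complex.exp z)) =ᶠ[nhds w] fun z =>
      (fderiv ℝ f (Complex.exp z)).comp ((Complex.exp z) • (ContinuousLinearMap.id ℝ ℂ)) := by
    filter_upwards [hev] with z hz
    exact (hz.hasFDerivAt.comp z (hexp z)).fderiv
  have h2 := (differentiableAt_fderiv hf).hasFDerivAt.comp w (hexp w)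
  have h3 : HasFDerivAt (fun z => (Complex.exp z) • (ContinuousLinearMap.id ℝ ℂ)) _ w :=
    (hexp w).smul_const _
  have h4 := h2.clm_comp h3
  unfold lap
  rw [h1.fderiv_eq]
  change fderiv ℝ (fun z => ((fderiv ℝ f ∘ Complex.exp) z).comp
    (Complex.exp z • ContinuousLinearMap.id ℝ ℂ)) w 1 1 + fderiv ℝ (fun z =>
    ((fderiv ℝ f ∘ Complex.exp) z).comp
    (Complex.exp z • ContinuousLinearMap.id ℝ ℂ)) w Complex.I Complex.I = _
  rw [h4.fderiv]
  set e := Complex.exp w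
  set D := fderiv ℝ (fderiv ℝ f) e
  have he : e = e.re • (1 : ℂ) + e.im • Complex.I := by simp
  have hIe : e * Complex.I = (-e.im) • (1 : ℂ) + e.re • Complex.I := by
    apply Complex.ext <;> simp
  have hn : (‖e‖ : ℂ) ^ 2 = ((e.re ^ 2 + e.im ^ 2 : ℝ) : ℂ) := by
    norm_cast
    rw [Complex.sq_norm, Complex.normSq_apply]; ring
  have key : D e e + D (e * Complex.I) (e * Complex.I) =
      ((e.re ^ 2 + e.im ^ 2 : ℝ) : ℂ) * (D 1 1 + D Complex.I Complex.I) := by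
    have hab : ∀ a b : ℝ, D (a • (1 : ℂ) + b • Complex.I) (a • (1 : ℂ) + b • Complex.I) =
        a * a * D 1 1 + a * b * (D 1 Complex.I + D Complex.I 1) +
          b * b * D Complex.I Complex.I := fun a b => by
      simp only [map_add, map_smul, add_apply, smul_apply]
      simp only [Complex.real_smul]
      ring
    have hee := hab e.re e.im
    rw [← he] at hee
    rw [hIe, hab, hee]
    push_cast
    ring
  have hneg : (fderiv ℝ f e) (e * Complex.I * Complex.I) = - fderiv ℝ f e e := by
    rw [← map_neg]; congr 1
    rw [mul_assoc, Complex.I_mul_I]; ring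
  simp only [add_apply, ContinuousLinearMap.comp_apply,
    ContinuousLinearMap.compL_apply, ContinuousLinearMap.flip_apply,
    smul_apply, ContinuousLinearMap.smulRight_apply,
    ContinuousLinearMap.id_apply, Function.comp_apply, smul_eq_mul, mul_one]
  rw [hn, ← key, hneg]
  ring

open Complex in
lemma laplacian_comp_repr {f : ℂ → ℂ} {x : EuclideanSpace ℝ (Fin 2)}
    (hf : ContDiffAt ℝ 2 f (orthonormalBasisOneI.repr.symm x)) :
    laplacian (fun y => f (orthonormalBasisOneI.repr.symm y)) x =
      lap f (orthonormalBasisOneI.repr.symm x) := by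
  set J : EuclideanSpace ℝ (Fin 2) ≃L[ℝ] ℂ :=
    orthonormalBasisOneI.repr.symm.toContinuousLinearEquiv with hJ
  have hJe : ∀ i, J (EuclideanSpace.single i 1) = orthonormalBasisOneI i := fun i => by
    simp [hJ]
  have hs : ∀ v : EuclideanSpace ℝ (Fin 2),
      fderiv ℝ (fun y => fderiv ℝ (fun z => f (J z)) y v) x v =
        fderiv ℝ (fderiv ℝ f) (J x) (J v) (J v) := by
    intro v
    have h1 : (fun y => fderiv ℝ (fun z => f (J z)) y v) = fun y => fderiv ℝ f (J y) (J v) := by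
      ext y
      have := J.comp_right_fderiv (f := f) (x := y)
      change fderiv ℝ (f ∘ J) y v = _
      rw [this]; rfl
    rw [h1]
    have h2 : HasFDerivAt (fun y => fderiv ℝ f (J y))
        ((fderiv ℝ (fderiv ℝ f) (J x)).comp (J : EuclideanSpace ℝ (Fin 2) →L[ℝ] ℂ)) x :=
      (differentiableAt_fderiv hf).hasFDerivAt.comp x J.hasFDerivAt
    rw [(h2.clm_apply (hasFDerivAt_const (J v) x)).fderiv]
    simp
  change laplacian (fun y => f (J y)) x = lap f (J x)
  unfold laplacian lap
  rw [Fin.sum_univ_two, hs, hs, hJe, hJe]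
  simp

/-- A smooth real amplitude times the exponential of a complex phase. -/
noncomputable def wave (ψ A χ Φ : ℝ → ℝ) (m : ℝ) (w : ℂ) : ℂ :=
  ψ w.re * Complex.exp (A w.re + (m * w.im + χ w.re * Φ w.im : ℝ) * Complex.I)

section wave

variable {ψ A χ Φ : ℝ → ℝ} {m : ℝ}

lemma contDiff_wave (hψ : ContDiff ℝ 2 ψ) (hA : ContDiff ℝ 2 A) (hχ : ContDiff ℝ 2 χ)
    (hΦ : ContDiff ℝ 2 Φ) : ContDiff ℝ 2 (wave ψ A χ Φ m) := by
  have hre : ContDiff ℝ 2 Complex.re := Complex.reCLM.contDiff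
  have him : ContDiff ℝ 2 Complex.im := Complex.imCLM.contDiff
  have hof : ContDiff ℝ 2 Complex.ofReal := Complex.ofRealCLM.contDiff
  have h1 := hof.comp (hψ.comp hre)
  have h2 := hof.comp (hA.comp hre)
  have h3 := hof.comp ((contDiff_const (c := m).mul him).add ((hχ.comp hre).mul (hΦ.comp him)))
  exact h1.mul (h2.add (h3.mul contDiff_const)).cexp

lemma norm_wave (w : ℂ) : ‖wave ψ A χ Φ m w‖ = |ψ w.re| * Real.exp (A w.re) := by
  simp [wave, Complex.norm_exp]

/-- The logarithmic Laplacian of a wave with unit amplitude. -/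
noncomputable def waveSymbol (A χ Φ : ℝ → ℝ) (m : ℝ) (w : ℂ) : ℂ :=
  (deriv (deriv A) w.re + (deriv (deriv χ) w.re * Φ w.im : ℝ) * Complex.I) +
    (χ w.re * deriv (deriv Φ) w.im : ℝ) * Complex.I +
    (deriv A w.re + (deriv χ w.re * Φ w.im : ℝ) * Complex.I) ^ 2 -
    (m + χ w.re * deriv Φ w.im : ℝ) ^ 2

lemma hasDerivAt_of_contDiff {f : ℝ → ℝ} (hf : ContDiff ℝ 2 f) (t : ℝ) :
    HasDerivAt f (deriv f t) t ∧ HasDerivAt (deriv f) (deriv (deriv f) t) t := by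
  refine ⟨(hf.differentiable (by norm_num) t).hasDerivAt, ?_⟩
  have h1 : ContDiff ℝ (1 + 1) f := hf.of_le (by norm_num)
  exact ((contDiff_succ_iff_deriv.1 h1).2.2.differentiable (by norm_num) t).hasDerivAt

lemma lap_wave (hψ : ContDiff ℝ 2 ψ) (hA : ContDiff ℝ 2 A) (hχ : ContDiff ℝ 2 χ)
    (hΦ : ContDiff ℝ 2 Φ) (w : ℂ) : lap (wave ψ A χ Φ m) w =
      (deriv (deriv ψ) w.re + 2 * deriv ψ w.re *
        (deriv A w.re + (deriv χ w.re * Φ w.im : ℝ) * Complex.I) +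
        ψ w.re * waveSymbol A χ Φ m w) *
      Complex.exp (A w.re + (m * w.im + χ w.re * Φ w.im : ℝ) * Complex.I) := by
  have hF := contDiff_wave (m := m) hψ hA hχ hΦ
  set E : ℂ → ℂ := fun z =>
    Complex.exp (A z.re + (m * z.im + χ z.re * Φ z.im : ℝ) * Complex.I) with hE
  set a : ℂ → ℂ := fun z => deriv A z.re + (deriv χ z.re * Φ z.im : ℝ) * Complex.I with ha
  set b : ℂ → ℂ := fun z => (m + χ z.re * deriv Φ z.im : ℝ) * Complex.I with hb
  have shift : ∀ {f : ℝ → ℝ} {f' : ℝ} (c t : ℝ), HasDerivAt f f' (c + t) →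
      HasDerivAt (fun t : ℝ => ((f (c + t) : ℝ) : ℂ)) f' t := fun c t hf =>
    (hf.comp_const_add c t).ofReal_comp
  have re1 : ∀ t : ℝ, (w + t * (1 : ℂ)).re = w.re + t := fun t => by simp
  have im1 : ∀ t : ℝ, (w + t * (1 : ℂ)).im = w.im := fun t => by simp
  have reI : ∀ t : ℝ, (w + t * Complex.I).re = w.re := fun t => by simp
  have imI : ∀ t : ℝ, (w + t * Complex.I).im = w.im + t := fun t => by simp
  have hE1 : ∀ t : ℝ, HasDerivAt (fun t : ℝ => E (w + t * (1 : ℂ)))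
      (E (w + t * (1 : ℂ)) * a (w + t * (1 : ℂ))) t := fun t => by
    simp only [hE, ha, re1, im1]
    refine HasDerivAt.cexp ?_
    refine (shift _ t (hasDerivAt_of_contDiff hA _).1).add (HasDerivAt.mul_const ?_ _)
    push_cast
    exact ((shift _ t (hasDerivAt_of_contDiff hχ _).1).mul_const _).const_add _
  have hE2 : ∀ t : ℝ, HasDerivAt (fun t : ℝ => E (w + t * Complex.I))
      (E (w + t * Complex.I) * b (w + t * Complex.I)) t := fun t => by
    simp only [hE, hb, reI, imI]
    refine HasDerivAt.cexp ?_
    refine (HasDerivAt.mul_const ?_ _).const_add _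
    push_cast
    refine HasDerivAt.add ?_ ((shift _ t (hasDerivAt_of_contDiff hΦ _).1).const_mul _)
    have := (shift (f := id) w.im t (hasDerivAt_id _)).const_mul (m : ℂ)
    simpa using this
  have h1 : fderiv ℝ (fderiv ℝ (wave ψ A χ Φ m)) w 1 1 =
      (deriv (deriv ψ) w.re + 2 * deriv ψ w.re * a w + ψ w.re *
        ((deriv (deriv A) w.re + (deriv (deriv χ) w.re * Φ w.im : ℝ) * Complex.I) + a w ^ 2)) *
        E w := by
    refine fderiv_fderiv_apply_eq hF
      (f' := fun z => deriv ψ z.re * E z + ψ z.re * (E z * a z)) (fun t => ?_) ?_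
    · have := (shift w.re t (hasDerivAt_of_contDiff hψ _).1).mul (hE1 t)
      change HasDerivAt (fun t : ℝ => (ψ (w + t * (1 : ℂ)).re : ℂ) * E (w + t * (1 : ℂ))) _ t
      simp only [re1]
      exact this
    · have ha1 : HasDerivAt (fun t : ℝ => a (w + t * (1 : ℂ)))
          (deriv (deriv A) (w.re + 0) +
            (deriv (deriv χ) (w.re + 0) * Φ w.im : ℝ) * Complex.I) 0 := by
        simp only [ha, re1, im1]
        refine (shift _ 0 (hasDerivAt_of_contDiff hA _).2).add (HasDerivAt.mul_const ?_ _)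
        push_cast
        exact ((shift _ 0 (hasDerivAt_of_contDiff hχ _).2).mul_const _)
      have := ((shift w.re 0 (hasDerivAt_of_contDiff hψ _).2).mul (hE1 0)).add
        ((shift w.re 0 (hasDerivAt_of_contDiff hψ _).1).mul ((hE1 0).mul ha1))
      refine HasDerivAt.congr_deriv (f := fun t : ℝ => ((deriv ψ (w + t * (1 : ℂ)).re : ℝ) : ℂ) *
        E (w + t * (1 : ℂ)) + ψ (w + t * (1 : ℂ)).re *
          (E (w + t * (1 : ℂ)) * a (w + t * (1 : ℂ)))) (by simp only [re1]; exact this) ?_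
      simp only [Complex.ofReal_zero, zero_mul, add_zero, Pi.mul_apply]
      ring
  have h2 : fderiv ℝ (fderiv ℝ (wave ψ A χ Φ m)) w Complex.I Complex.I =
      ψ w.re * ((χ w.re * deriv (deriv Φ) w.im : ℝ) * Complex.I + b w ^ 2) * E w := by
    refine fderiv_fderiv_apply_eq hF
      (f' := fun z => ψ z.re * (E z * b z)) (fun t => ?_) ?_
    · have := (hE2 t).const_mul (ψ w.re : ℂ)
      change HasDerivAt (fun t : ℝ => (ψ (w + t * Complex.I).re : ℂ) * E (w + t * Complex.I)) _ t
      simpa only [reI] using this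
    · have hb1 : HasDerivAt (fun t : ℝ => b (w + t * Complex.I))
          ((χ w.re * deriv (deriv Φ) (w.im + 0) : ℝ) * Complex.I) 0 := by
        simp only [hb, reI, imI]
        refine HasDerivAt.mul_const ?_ _
        push_cast
        exact ((shift _ 0 (hasDerivAt_of_contDiff hΦ _).2).const_mul _).const_add _
      have := (((hE2 0).mul hb1)).const_mul (ψ w.re : ℂ)
      refine HasDerivAt.congr_deriv (f := fun t : ℝ => (ψ (w + t * Complex.I).re : ℂ) *
        (E (w + t * Complex.I) * b (w + t * Complex.I))) (by simp only [reI]; exact this) ?_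
      simp only [Complex.ofReal_zero, zero_mul, add_zero]
      ring
  rw [lap, h1, h2]
  simp only [waveSymbol, hb, mul_pow, Complex.I_sq]
  ring

end wave

lemma exists_bound_deriv_smoothTransition : ∃ M : ℝ, ∀ x,
    |deriv smoothTransition x| ≤ M ∧ |deriv (deriv smoothTransition) x| ≤ M := by
  have hS : ContDiff ℝ 2 smoothTransition := Real.smoothTransition.contDiff
  have h1 : ContDiff ℝ 1 (deriv smoothTransition) :=
    (contDiff_succ_iff_deriv.1 (hS.of_le (by norm_num) : ContDiff ℝ (1 + 1) _)).2.2
  have h2 : Continuous (deriv (deriv smoothTransition)) := h1.continuous_deriv (by norm_num)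
  have hz : ∀ x ∉ Set.Icc (0 : ℝ) 1, deriv smoothTransition =ᶠ[nhds x] fun _ => 0 := by
    intro x hx
    have : ∀ᶠ y in nhds x, y ∉ Set.Icc (0 : ℝ) 1 := isClosed_Icc.isOpen_compl.mem_nhds hx
    filter_upwards [this.eventually_nhds] with y hy
    by_cases h0 : y < 0
    · have : smoothTransition =ᶠ[nhds y] fun _ => 0 := by
        filter_upwards [gt_mem_nhds h0] with z hz
        exact smoothTransition.zero_of_nonpos hz.le
      rw [this.deriv_eq]; simp
    · have h1 : 1 < y := by
        by_contra h1
        exact hy.self_of_nhds ⟨not_lt.1 h0, not_lt.1 h1⟩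
      have : smoothTransition =ᶠ[nhds y] fun _ => 1 := by
        filter_upwards [lt_mem_nhds h1] with z hz
        exact smoothTransition.one_of_one_le hz.le
      rw [this.deriv_eq]; simp
  obtain ⟨M1, hM1⟩ := isCompact_Icc.exists_bound_of_continuousOn
    (s := Set.Icc (0 : ℝ) 1) h1.continuous.continuousOn
  obtain ⟨M2, hM2⟩ := isCompact_Icc.exists_bound_of_continuousOn
    (s := Set.Icc (0 : ℝ) 1) h2.continuousOn
  have hM0 : 0 ≤ M1 := (norm_nonneg _).trans (hM1 0 (by simp))
  refine ⟨max M1 M2, fun x => ?_⟩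
  by_cases hx : x ∈ Set.Icc (0 : ℝ) 1
  · exact ⟨(hM1 x hx).trans (le_max_left _ _), (hM2 x hx).trans (le_max_right _ _)⟩
  · rw [(hz x hx).self_of_nhds, (hz x hx).deriv_eq]
    simp [hM0]

/-- A smooth step, in the variable `exp (Λ s) - k`, from `0` at `i / 8` to `1` at `(i + 1) / 8`. -/
noncomputable def step (Λ : ℝ) (k : ℕ) (i : ℝ) (s : ℝ) : ℝ :=
  smoothTransition (8 * (exp (Λ * s) - k) - i)

section step

variable {Λ : ℝ} {k : ℕ} {i s : ℝ}

lemma contDiff_step : ContDiff ℝ 2 (step Λ k i) := by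
  have hS : ContDiff ℝ 2 smoothTransition := Real.smoothTransition.contDiff
  unfold step
  exact hS.comp (by fun_prop)

lemma step_nonneg : 0 ≤ step Λ k i s := smoothTransition.nonneg _

lemma step_le_one : step Λ k i s ≤ 1 := smoothTransition.le_one _

lemma step_eq_zero (h : exp (Λ * s) - k ≤ i / 8) : step Λ k i s = 0 :=
  smoothTransition.zero_of_nonpos (by linarith)

lemma step_eq_one (h : (i + 1) / 8 ≤ exp (Λ * s) - k) : step Λ k i s = 1 :=
  smoothTransition.one_of_one_le (by linarith)

lemma deriv_of_eventuallyEq_const {f : ℝ → ℝ} {c : ℝ} (h : f =ᶠ[nhds s] fun _ => c) :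
    deriv f s = 0 ∧ deriv (deriv f) s = 0 := by
  have h1 : deriv f =ᶠ[nhds s] fun _ => 0 := by
    filter_upwards [h.deriv] with t ht
    simpa using ht
  exact ⟨h1.self_of_nhds, by rw [h1.deriv_eq]; simp⟩

lemma deriv_step_of_lt (h : exp (Λ * s) - k < i / 8) :
    deriv (step Λ k i) s = 0 ∧ deriv (deriv (step Λ k i)) s = 0 := by
  refine deriv_of_eventuallyEq_const (c := 0) ?_
  have hc : ContinuousAt (fun s => exp (Λ * s) - k) s := by fun_prop
  filter_upwards [hc.eventually (gt_mem_nhds h)] with t ht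
  exact step_eq_zero ht.le

lemma deriv_step_of_gt (h : (i + 1) / 8 < exp (Λ * s) - k) :
    deriv (step Λ k i) s = 0 ∧ deriv (deriv (step Λ k i)) s = 0 := by
  refine deriv_of_eventuallyEq_const (c := 1) ?_
  have hc : ContinuousAt (fun s => exp (Λ * s) - k) s := by fun_prop
  filter_upwards [hc.eventually (lt_mem_nhds h)] with t ht
  exact step_eq_one ht.le

lemma hasDerivAt_step : HasDerivAt (step Λ k i)
    (deriv smoothTransition (8 * (exp (Λ * s) - k) - i) * (8 * (exp (Λ * s) * Λ))) s := by
  have hS : ContDiff ℝ 2 smoothTransition := Real.smoothTransition.contDiff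
  have h1 : HasDerivAt (fun s => 8 * (exp (Λ * s) - k) - i) (8 * (exp (Λ * s) * Λ)) s := by
    have := ((((hasDerivAt_id s).const_mul Λ).exp.sub_const (k : ℝ)).const_mul 8).sub_const i
    simpa using this
  exact (hasDerivAt_of_contDiff hS _).1.comp s h1

lemma deriv_deriv_step : deriv (deriv (step Λ k i)) s =
    deriv (deriv smoothTransition) (8 * (exp (Λ * s) - k) - i) * (8 * (exp (Λ * s) * Λ)) ^ 2 +
    deriv smoothTransition (8 * (exp (Λ * s) - k) - i) * (8 * (exp (Λ * s) * Λ ^ 2)) := by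
  have hS : ContDiff ℝ 2 smoothTransition := Real.smoothTransition.contDiff
  have h1 : HasDerivAt (fun s => 8 * (exp (Λ * s) - k) - i) (8 * (exp (Λ * s) * Λ)) s := by
    have := ((((hasDerivAt_id s).const_mul Λ).exp.sub_const (k : ℝ)).const_mul 8).sub_const i
    simpa using this
  have h2 : HasDerivAt (fun s => 8 * (exp (Λ * s) * Λ)) (8 * (exp (Λ * s) * Λ * Λ)) s := by
    have := (((hasDerivAt_id s).const_mul Λ).exp.mul_const Λ).const_mul 8
    simpa using this
  have h3 := ((hasDerivAt_of_contDiff hS (8 * (exp (Λ * s) - k) - i)).2.comp s h1).mul h2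
  have h4 : deriv (step Λ k i) = fun s =>
    deriv smoothTransition (8 * (exp (Λ * s) - k) - i) * (8 * (exp (Λ * s) * Λ)) :=
    funext fun s => hasDerivAt_step.deriv
  rw [h4]
  refine h3.deriv.trans ?_
  simp only [Function.comp_apply]
  ring

lemma exists_bound_deriv_step (Λ : ℝ) : ∃ M : ℝ, 0 ≤ M ∧ ∀ (k : ℕ) (i s : ℝ), 1 ≤ k →
    exp (Λ * s) ≤ k + 1 → |deriv (step Λ k i) s| ≤ M * k ∧
      |deriv (deriv (step Λ k i)) s| ≤ M * k ^ 2 := by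
  obtain ⟨M, hM⟩ := exists_bound_deriv_smoothTransition
  have hM0 : 0 ≤ M := (abs_nonneg _).trans (hM 0).1
  refine ⟨M * (16 * |Λ|) + M * (16 * |Λ|) ^ 2 + M * (16 * |Λ| ^ 2), by positivity, ?_⟩
  intro k i s hk hy
  have hk1 : (1 : ℝ) ≤ k := by exact_mod_cast hk
  have hy2 : exp (Λ * s) ≤ 2 * k := by linarith
  have hy0 := exp_pos (Λ * s)
  have e1 : |8 * (exp (Λ * s) * Λ)| ≤ (16 * |Λ|) * k := by
    rw [abs_mul, abs_mul, abs_of_pos hy0, abs_of_pos (by norm_num : (0 : ℝ) < 8)]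
    nlinarith [abs_nonneg Λ, mul_le_mul_of_nonneg_right hy2 (abs_nonneg Λ)]
  have e2 : |8 * (exp (Λ * s) * Λ ^ 2)| ≤ (16 * |Λ| ^ 2) * k := by
    rw [abs_mul, abs_mul, abs_of_pos hy0, abs_of_pos (by norm_num : (0 : ℝ) < 8), abs_pow]
    nlinarith [sq_nonneg |Λ|, mul_le_mul_of_nonneg_right hy2 (sq_nonneg |Λ|)]
  have hkk : (k : ℝ) ≤ k ^ 2 := by nlinarith
  constructor
  · rw [hasDerivAt_step.deriv, abs_mul]
    calc _ ≤ M * ((16 * |Λ|) * k) := mul_le_mul (hM _).1 e1 (abs_nonneg _) hM0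
      _ ≤ _ := by
        have : 0 ≤ (M * (16 * |Λ|) ^ 2 + M * (16 * |Λ| ^ 2)) * k := by positivity
        linarith
  · rw [deriv_deriv_step]
    refine (abs_add_le _ _).trans ?_
    rw [abs_mul, abs_mul, abs_pow]
    calc _ ≤ M * ((16 * |Λ|) * k) ^ 2 + M * ((16 * |Λ| ^ 2) * k) := by
          refine add_le_add (mul_le_mul (hM _).2 (pow_le_pow_left₀ (abs_nonneg _) e1 2)
            (by positivity) hM0) (mul_le_mul (hM _).1 e2 (abs_nonneg _) hM0)
      _ ≤ _ := by
        have h1 : 0 ≤ (M * (16 * |Λ|)) * (k : ℝ) ^ 2 := by positivity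
        have h2 : (M * (16 * |Λ| ^ 2)) * (k : ℝ) ≤ (M * (16 * |Λ| ^ 2)) * (k : ℝ) ^ 2 :=
          mul_le_mul_of_nonneg_left hkk (by positivity)
        linarith

end step

/-- A smooth `2π`-periodic function equal to `-θ` near the multiples of the period. -/
noncomputable def saw (θ : ℝ) : ℝ :=
  -(Complex.log (Complex.exp (θ * Complex.I))).im * smoothTransition (cos θ + 1 / 2)

lemma saw_add_int_mul (θ : ℝ) (n : ℤ) : saw (θ + n * (2 * π)) = saw θ := by
  unfold saw
  rw [cos_add_int_mul_two_pi]
  congr 4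
  rw [Complex.exp_eq_exp_iff_exists_int]
  exact ⟨n, by push_cast; ring⟩

lemma exp_mul_I_mem_slitPlane {θ : ℝ} (h : -1 < cos θ) :
    Complex.exp (θ * Complex.I) ∈ Complex.slitPlane := by
  rw [Complex.mem_slitPlane_iff]
  by_contra hc
  push Not at hc
  rw [Complex.exp_ofReal_mul_I_re, Complex.exp_ofReal_mul_I_im] at hc
  nlinarith [sin_sq_add_cos_sq θ]

lemma hasDerivAt_log_exp {θ : ℝ} (h : -1 < cos θ) :
    HasDerivAt (fun θ : ℝ => (Complex.log (Complex.exp (θ * Complex.I))).im) 1 θ := by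
  have hs := exp_mul_I_mem_slitPlane h
  have h1 : HasDerivAt (fun θ : ℝ => Complex.exp (θ * Complex.I))
      (Complex.exp (θ * Complex.I) * Complex.I) θ := by
    have := ((Complex.ofRealCLM.hasDerivAt (x := θ)).mul_const Complex.I).cexp
    simpa using this
  have h2 := h1.clog_real hs
  have h3 := Complex.imCLM.hasFDerivAt.comp_hasDerivAt θ h2
  rw [mul_div_cancel_left₀ _ (Complex.exp_ne_zero _)] at h3
  simpa [Function.comp_def] using h3

lemma contDiff_saw : ContDiff ℝ 2 saw := by
  have hS : ContDiff ℝ 2 smoothTransition := Real.smoothTransition.contDiff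
  rw [contDiff_iff_contDiffAt]
  intro θ
  by_cases h : cos θ < -1 / 2
  · have : saw =ᶠ[nhds θ] fun _ => 0 := by
      filter_upwards [continuous_cos.continuousAt.eventually (gt_mem_nhds h)] with t ht
      rw [saw, smoothTransition.zero_of_nonpos (by linarith), mul_zero]
    exact contDiffAt_const.congr_of_eventuallyEq this
  · have h1 : -1 < cos θ := by linarith [not_lt.1 h]
    have hs := exp_mul_I_mem_slitPlane h1
    have e1 : ContDiff ℝ 2 fun θ : ℝ => Complex.exp (θ * Complex.I) :=
      (Complex.ofRealCLM.contDiff.mul contDiff_const).cexp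
    have e2 := Complex.imCLM.contDiff.contDiffAt.comp θ
      (((Complex.contDiffAt_log (n := 2) hs).restrict_scalars ℝ).comp θ e1.contDiffAt)
    exact e2.neg.mul (hS.comp (contDiff_cos.add contDiff_const)).contDiffAt

lemma deriv_saw {θ : ℝ} (h : 1 / 2 < cos θ) :
    deriv saw θ = -1 ∧ deriv (deriv saw) θ = 0 := by
  have h1 : ∀ t, 1 / 2 < cos t → deriv saw t = -1 := by
    intro t ht
    have : saw =ᶠ[nhds t] fun t => -(Complex.log (Complex.exp (t * Complex.I))).im := by
      filter_upwards [continuous_cos.continuousAt.eventually (lt_mem_nhds ht)] with x hx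
      rw [saw, smoothTransition.one_of_one_le (by linarith), mul_one]
    rw [this.deriv_eq]
    exact (hasDerivAt_log_exp (by linarith)).neg.deriv
  have h2 : deriv saw =ᶠ[nhds θ] fun _ => -1 := by
    filter_upwards [continuous_cos.continuousAt.eventually (lt_mem_nhds h)] with x hx
    exact h1 x hx
  exact ⟨h1 θ h, by rw [h2.deriv_eq]; simp⟩

lemma exists_bound_saw : ∃ M : ℝ, ∀ θ,
    |saw θ| ≤ M ∧ |deriv saw θ| ≤ M ∧ |deriv (deriv saw) θ| ≤ M := by
  have h1 : ContDiff ℝ 1 (deriv saw) :=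
    (contDiff_succ_iff_deriv.1 (contDiff_saw.of_le (by norm_num) : ContDiff ℝ (1 + 1) _)).2.2
  have h2 : Continuous (deriv (deriv saw)) := h1.continuous_deriv (by norm_num)
  have p0 : Function.Periodic saw (2 * π) := fun θ => by simpa using saw_add_int_mul θ 1
  have hper : ∀ {f : ℝ → ℝ}, Function.Periodic f (2 * π) →
      Function.Periodic (deriv f) (2 * π) := fun {f} hf θ => by
    rw [← deriv_comp_add_const]
    congr 1
    exact funext hf
  have hb : ∀ {f : ℝ → ℝ}, Continuous f → Function.Periodic f (2 * π) →
      ∃ M, ∀ θ, |f θ| ≤ M := fun {f} hc hf => by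
    obtain ⟨M, hM⟩ := isCompact_Icc.exists_bound_of_continuousOn
      (s := Set.Icc (0 : ℝ) (0 + 2 * π)) hc.continuousOn
    refine ⟨M, fun θ => ?_⟩
    obtain ⟨y, hy, he⟩ := hf.exists_mem_Ico₀ (by positivity) θ
    rw [he]
    exact hM y ⟨hy.1, by linarith [hy.2]⟩
  obtain ⟨M0, hM0⟩ := hb contDiff_saw.continuous p0
  obtain ⟨M1, hM1⟩ := hb h1.continuous (hper p0)
  obtain ⟨M2, hM2⟩ := hb h2 (hper (hper p0))
  exact ⟨max M0 (max M1 M2), fun θ => ⟨(hM0 θ).trans (by simp), (hM1 θ).trans (by simp),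
    (hM2 θ).trans (by simp)⟩⟩

lemma cos_add_mul_saw_le {θ κ : ℝ} (h : cos θ ≤ 1 / 2) (h0 : 0 ≤ κ) (h1 : κ ≤ 10 / 13) :
    cos (θ + κ * saw θ) ≤ cos (π / 13) := by
  set θ₀ := (Complex.log (Complex.exp (θ * Complex.I))).im with hθ₀
  have hexp : Complex.exp (θ₀ * Complex.I) = Complex.exp (θ * Complex.I) := by
    have e := Complex.exp_log (Complex.exp_ne_zero (θ * Complex.I))
    rw [← Complex.re_add_im (Complex.log (Complex.exp (θ * Complex.I))), ← hθ₀] at e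
    rw [Complex.log_re, Complex.norm_exp_ofReal_mul_I] at e
    simpa using e
  obtain ⟨n, hn⟩ := Complex.exp_eq_exp_iff_exists_int.1 hexp
  have hn' : θ₀ = θ + n * (2 * π) := by
    have : ((θ₀ : ℂ) - (θ + n * (2 * π))) * Complex.I = 0 := by rw [sub_mul, hn]; ring
    have h2 := (mul_eq_zero.1 this).resolve_right Complex.I_ne_zero
    have h3 := sub_eq_zero.1 h2
    exact_mod_cast h3
  have hle : |θ₀| ≤ π := by
    rw [abs_le]
    exact ⟨(Complex.neg_pi_lt_log_im _).le, Complex.log_im_le_pi _⟩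
  have hcos : cos |θ₀| ≤ cos (π / 3) := by
    rw [cos_abs, hn', cos_add_int_mul_two_pi, cos_pi_div_three]; exact h
  have hge : π / 3 ≤ |θ₀| := by
    by_contra hc
    exact absurd (cos_lt_cos_of_nonneg_of_le_pi (abs_nonneg _) (by linarith [pi_pos])
      (not_le.1 hc)) (not_lt.2 hcos)
  set c := smoothTransition (cos θ + 1 / 2) with hc
  have hc0 : 0 ≤ c := smoothTransition.nonneg _
  have hc1 : c ≤ 1 := smoothTransition.le_one _
  have e1 : cos (θ + κ * saw θ) = cos (|θ₀| * (1 - κ * c)) := by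
    have : saw θ = -θ₀ * c := rfl
    rw [this, ← cos_add_int_mul_two_pi _ n, ← cos_abs (_ + _)]
    have h4 : θ + κ * (-θ₀ * c) + n * (2 * π) = θ₀ * (1 - κ * c) := by
      linear_combination -hn'
    have h5 : 0 ≤ 1 - κ * c := by nlinarith
    rw [h4, abs_mul, abs_of_nonneg h5]
  have hκc : κ * c ≤ 10 / 13 := by nlinarith
  have hκ0 : 0 ≤ κ * c := by positivity
  rw [e1]
  have hp := pi_pos
  refine cos_le_cos_of_nonneg_of_le_pi (by positivity) ?_ ?_
  · nlinarith [abs_nonneg θ₀]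
  · nlinarith [abs_nonneg θ₀]

/-- The angular frequency at the inner boundary of the `k`-th annulus. -/
noncomputable def freq (k : ℕ) : ℝ := ((k : ℝ) + 1) ^ 2

/-- The increment of the angular frequency across the `k`-th annulus. -/
noncomputable def gap (k : ℕ) : ℝ := 2 * k + 3

/-- The alternating sign of the angular frequency. -/
noncomputable def sgn (k : ℕ) : ℝ := (-1) ^ k

/-- The logarithmic radius at which the two waves of the `k`-th annulus have equal size. -/
noncomputable def balance (Λ : ℝ) (k : ℕ) : ℝ := log (k + 3 / 8) / Λ

/-- The number of zeros in the `k`-th annulus. -/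
noncomputable def zeros (k : ℕ) : ℝ := freq k + freq (k + 1)

/-- The logarithm of the modulus of the outgoing wave. -/
noncomputable def logAmp (Λ : ℝ) (k : ℕ) (s : ℝ) : ℝ :=
  -freq k * s + gap k * (1 - 2 * step Λ k 5 s) * (s - balance Λ k)

/-- The phase correction making the outgoing wave antiholomorphic near the zeros. -/
noncomputable def phase (k : ℕ) (φ : ℝ) : ℝ := 2 * gap k / zeros k * saw (sgn k * zeros k * φ)

/-- The wave entering the `k`-th annulus, cut off in the middle. -/
noncomputable def waveIn (Λ : ℝ) (k : ℕ) : ℂ → ℂ :=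
  wave (fun s => 1 - step Λ k 4 s) (fun s => -freq k * s) (fun _ => 0) (fun _ => 0)
    (-(sgn k * freq k))

/-- The wave leaving the `k`-th annulus, cut off near the inner boundary. -/
noncomputable def waveOut (Λ : ℝ) (k : ℕ) : ℂ → ℂ :=
  wave (step Λ k 1) (logAmp Λ k) (fun s => 1 - step Λ k 5 s) (phase k) (sgn k * freq (k + 1))

/-- The solution in the `k`-th annulus, in logarithmic coordinates and up to a constant. -/
noncomputable def block (Λ : ℝ) (k : ℕ) (w : ℂ) : ℂ := waveIn Λ k w - waveOut Λ k w

section block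

variable {Λ : ℝ} {k : ℕ} {s : ℝ} {w : ℂ}

lemma freq_succ (k : ℕ) : freq (k + 1) = freq k + gap k := by
  unfold freq gap; push_cast; ring

lemma freq_pos (k : ℕ) : 0 < freq k := by unfold freq; positivity

lemma gap_pos (k : ℕ) : 0 < gap k := by unfold gap; positivity

lemma zeros_pos (k : ℕ) : 0 < zeros k := add_pos (freq_pos _) (freq_pos _)

lemma sgn_mul_self (k : ℕ) : sgn k * sgn k = 1 := by
  unfold sgn; rw [← mul_pow]; simp

lemma two_mul_gap_div_zeros_le (hk : 1 ≤ k) : 2 * gap k / zeros k ≤ 10 / 13 := by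
  have hk1 : (1 : ℝ) ≤ k := by exact_mod_cast hk
  rw [div_le_div_iff₀ (zeros_pos k) (by norm_num)]
  unfold gap zeros freq
  push_cast
  nlinarith

lemma contDiff_logAmp : ContDiff ℝ 2 (logAmp Λ k) := by
  have := contDiff_step (Λ := Λ) (k := k) (i := 5)
  unfold logAmp
  fun_prop

lemma contDiff_phase : ContDiff ℝ 2 (phase k) :=
  contDiff_const.mul (contDiff_saw.comp (by fun_prop))

lemma contDiff_one_sub_step {i : ℝ} : ContDiff ℝ 2 fun s => 1 - step Λ k i s :=
  contDiff_const.sub contDiff_step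

lemma contDiff_waveIn : ContDiff ℝ 2 (waveIn Λ k) :=
  contDiff_wave contDiff_one_sub_step (by fun_prop) contDiff_const contDiff_const

lemma contDiff_waveOut : ContDiff ℝ 2 (waveOut Λ k) :=
  contDiff_wave contDiff_step contDiff_logAmp contDiff_one_sub_step contDiff_phase

lemma contDiff_block : ContDiff ℝ 2 (block Λ k) := contDiff_waveIn.sub contDiff_waveOut

lemma deriv_logAmp : deriv (logAmp Λ k) = fun s => -freq k +
    (gap k * (1 - 2 * step Λ k 5 s) - 2 * gap k * deriv (step Λ k 5) s * (s - balance Λ k)) := by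
  ext s
  have hg := (hasDerivAt_of_contDiff (contDiff_step (Λ := Λ) (k := k) (i := 5)) s).1
  have h := ((hasDerivAt_id s).const_mul (-freq k)).add
    ((((hg.const_mul 2).const_sub 1).const_mul (gap k)).mul
      ((hasDerivAt_id s).sub_const (balance Λ k)))
  refine h.deriv.trans ?_
  simp only [id]
  ring

lemma deriv_deriv_logAmp : deriv (deriv (logAmp Λ k)) s = -4 * gap k * deriv (step Λ k 5) s -
    2 * gap k * deriv (deriv (step Λ k 5)) s * (s - balance Λ k) := by
  have hg := hasDerivAt_of_contDiff (contDiff_step (Λ := Λ) (k := k) (i := 5)) s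
  rw [deriv_logAmp]
  have h := ((((hg.1.const_mul 2).const_sub 1).const_mul (gap k)).sub
    ((hg.2.const_mul (2 * gap k)).mul ((hasDerivAt_id s).sub_const (balance Λ k)))).const_add
      (-freq k)
  refine h.deriv.trans ?_
  simp only [id]
  ring

lemma deriv_phase : deriv (phase k) = fun φ =>
    2 * gap k * sgn k * deriv saw (sgn k * zeros k * φ) := by
  ext φ
  have h := ((hasDerivAt_of_contDiff contDiff_saw (sgn k * zeros k * φ)).1.comp φ
    ((hasDerivAt_id φ).const_mul (sgn k * zeros k))).const_mul (2 * gap k / zeros k)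
  refine h.deriv.trans ?_
  have := (zeros_pos k).ne'
  field_simp

lemma deriv_deriv_phase (φ : ℝ) : deriv (deriv (phase k)) φ =
    2 * gap k * zeros k * deriv (deriv saw) (sgn k * zeros k * φ) := by
  rw [deriv_phase]
  have h := ((hasDerivAt_of_contDiff contDiff_saw (sgn k * zeros k * φ)).2.comp φ
    ((hasDerivAt_id φ).const_mul (sgn k * zeros k))).const_mul (2 * gap k * sgn k)
  refine h.deriv.trans ?_
  linear_combination (2 * gap k * zeros k * deriv (deriv saw) (sgn k * zeros k * φ)) *
    sgn_mul_self k

lemma deriv_one_sub_step {i : ℝ} :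
    deriv (fun s => 1 - step Λ k i s) = fun s => -deriv (step Λ k i) s := by
  ext s
  exact ((hasDerivAt_of_contDiff contDiff_step s).1.const_sub 1).deriv

lemma deriv_deriv_one_sub_step {i : ℝ} :
    deriv (deriv fun s => 1 - step Λ k i s) s = -deriv (deriv (step Λ k i)) s := by
  rw [deriv_one_sub_step]
  exact (hasDerivAt_of_contDiff contDiff_step s).2.neg.deriv

lemma deriv_freq_mul : (deriv fun s => -freq k * s) = fun _ => -freq k := by
  ext s
  simp

lemma lap_waveIn : lap (waveIn Λ k) w =
    ((-deriv (deriv (step Λ k 4)) w.re + 2 * freq k * deriv (step Λ k 4) w.re : ℝ) : ℂ) *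
      Complex.exp ((-freq k * w.re : ℝ) + (-(sgn k * freq k) * w.im + 0 * 0 : ℝ) * Complex.I) := by
  unfold waveIn
  rw [lap_wave contDiff_one_sub_step (by fun_prop) contDiff_const contDiff_const]
  congr 1
  have h := sgn_mul_self k
  simp only [waveSymbol, deriv_deriv_one_sub_step]
  simp only [deriv_one_sub_step, deriv_freq_mul, deriv_const']
  have h' : (sgn k : ℂ) * sgn k = 1 := by exact_mod_cast h
  push_cast
  linear_combination (-(1 - step Λ k 4 w.re : ℂ) * freq k ^ 2) * h'

lemma lap_waveOut : lap (waveOut Λ k) w =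
    (deriv (deriv (step Λ k 1)) w.re + 2 * deriv (step Λ k 1) w.re *
      (deriv (logAmp Λ k) w.re +
        (deriv (fun s => 1 - step Λ k 5 s) w.re * phase k w.im : ℝ) * Complex.I) +
      step Λ k 1 w.re * waveSymbol (logAmp Λ k) (fun s => 1 - step Λ k 5 s) (phase k)
        (sgn k * freq (k + 1)) w) *
    Complex.exp (logAmp Λ k w.re + (sgn k * freq (k + 1) * w.im +
      (1 - step Λ k 5 w.re) * phase k w.im : ℝ) * Complex.I) :=
  lap_wave contDiff_step contDiff_logAmp contDiff_one_sub_step contDiff_phase w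

lemma waveSymbol_eq : waveSymbol (logAmp Λ k) (fun s => 1 - step Λ k 5 s) (phase k)
    (sgn k * freq (k + 1)) w = (deriv (deriv (logAmp Λ k)) w.re : ℝ) -
      (deriv (deriv (step Λ k 5)) w.re * phase k w.im : ℝ) * Complex.I +
      ((1 - step Λ k 5 w.re) * deriv (deriv (phase k)) w.im : ℝ) * Complex.I +
      (((deriv (logAmp Λ k) w.re : ℝ) : ℂ) -
        (deriv (step Λ k 5) w.re * phase k w.im : ℝ) * Complex.I) ^ 2 -
      ((freq k + (gap k + (1 - step Λ k 5 w.re) * (2 * gap k *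
        deriv saw (sgn k * zeros k * w.im))) : ℝ) : ℂ) ^ 2 := by
  have h' : (sgn k : ℂ) * sgn k = 1 := by exact_mod_cast sgn_mul_self k
  simp only [waveSymbol, deriv_deriv_one_sub_step]
  simp only [deriv_one_sub_step, deriv_phase, freq_succ]
  push_cast
  linear_combination -((freq k : ℂ) + (gap k + (1 - step Λ k 5 w.re) * (2 * gap k *
        deriv saw (sgn k * zeros k * w.im)))) ^ 2 * h'

/-- Near the zeros the block is a sum of two harmonic waves. -/
lemma lap_block_eq_zero (h1 : 1 / 4 < exp (Λ * w.re) - k) (h2 : exp (Λ * w.re) - k < 1 / 2)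
    (h3 : 1 / 2 < cos (sgn k * zeros k * w.im)) : lap (block Λ k) w = 0 := by
  have g5 := deriv_step_of_lt (Λ := Λ) (k := k) (s := w.re) (i := 5) (by linarith)
  have e5 := step_eq_zero (Λ := Λ) (k := k) (s := w.re) (i := 5) (by linarith)
  have g4 := deriv_step_of_lt (Λ := Λ) (k := k) (s := w.re) (i := 4) (by linarith)
  have g1 := deriv_step_of_gt (Λ := Λ) (k := k) (s := w.re) (i := 1) (by linarith)
  have hs := deriv_saw h3
  have h0 : waveSymbol (logAmp Λ k) (fun s => 1 - step Λ k 5 s) (phase k)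
      (sgn k * freq (k + 1)) w = 0 := by
    rw [waveSymbol_eq, deriv_deriv_logAmp, deriv_logAmp, deriv_deriv_phase]
    simp only [g5, e5, hs]
    push_cast
    ring
  unfold block
  rw [lap_sub contDiff_waveIn contDiff_waveOut, lap_waveIn, lap_waveOut, h0]
  simp only [g4, g1]
  simp

end block

section estimates

variable {Λ : ℝ} {k : ℕ} {s : ℝ} {w : ℂ}

lemma mul_sub_balance_le (hΛ : 0 < Λ) :
    Λ * (s - balance Λ k) ≤ (exp (Λ * s) - (k + 3 / 8)) / (k + 3 / 8) := by
  have hb : (0 : ℝ) < k + 3 / 8 := by positivity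
  have h := log_le_sub_one_of_pos (div_pos (exp_pos (Λ * s)) hb)
  rw [log_div (exp_pos _).ne' hb.ne', log_exp] at h
  have e : Λ * (s - balance Λ k) = Λ * s - log (k + 3 / 8) := by
    unfold balance; field_simp
  rw [e, sub_div, div_self hb.ne']
  exact h

lemma le_mul_sub_balance (hΛ : 0 < Λ) :
    (exp (Λ * s) - (k + 3 / 8)) / exp (Λ * s) ≤ Λ * (s - balance Λ k) := by
  have hb : (0 : ℝ) < k + 3 / 8 := by positivity
  have h := log_le_sub_one_of_pos (div_pos hb (exp_pos (Λ * s)))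
  rw [log_div hb.ne' (exp_pos _).ne', log_exp] at h
  have e : Λ * (s - balance Λ k) = Λ * s - log (k + 3 / 8) := by
    unfold balance; field_simp
  rw [e, sub_div, div_self (exp_pos _).ne']
  linarith

lemma abs_sub_balance_mul_le (hΛ : 0 < Λ) (hk : 1 ≤ k) (h1 : k ≤ exp (Λ * s))
    (h2 : exp (Λ * s) ≤ k + 1) : |s - balance Λ k| * k ≤ 1 / Λ := by
  have hk1 : (1 : ℝ) ≤ k := by exact_mod_cast hk
  have hk0 : (0 : ℝ) < k := by linarith
  have hy := exp_pos (Λ * s)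
  have hu := (mul_sub_balance_le (k := k) (s := s) hΛ).trans
    (show _ ≤ 1 / (k : ℝ) by
      rw [div_le_div_iff₀ (by positivity) hk0]
      nlinarith)
  have hl := (show -(1 / (k : ℝ)) ≤ _ by
      rw [← neg_div, div_le_div_iff₀ hk0 hy]
      nlinarith).trans (le_mul_sub_balance (k := k) (s := s) hΛ)
  have h3 : |Λ * (s - balance Λ k)| ≤ 1 / k := abs_le.2 ⟨hl, hu⟩
  rw [abs_mul, abs_of_pos hΛ, le_div_iff₀ hk0] at h3
  rw [le_div_iff₀ hΛ]
  linarith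

/-- A common bound for all the functions entering the blocks. -/
structure Bounds (Λ M : ℝ) : Prop where
  one_le : 1 ≤ M
  deriv_step : ∀ (k : ℕ) (i s : ℝ), 1 ≤ k → exp (Λ * s) ≤ k + 1 →
    |deriv (step Λ k i) s| ≤ M * k
  deriv_deriv_step : ∀ (k : ℕ) (i s : ℝ), 1 ≤ k → exp (Λ * s) ≤ k + 1 →
    |deriv (deriv (step Λ k i)) s| ≤ M * k ^ 2
  saw : ∀ θ, |saw θ| ≤ M
  deriv_saw : ∀ θ, |deriv Meshkov.saw θ| ≤ M
  deriv_deriv_saw : ∀ θ, |deriv (deriv Meshkov.saw) θ| ≤ M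
  balance : ∀ (k : ℕ) (s : ℝ), 1 ≤ k → k ≤ exp (Λ * s) → exp (Λ * s) ≤ k + 1 →
    |s - balance Λ k| * k ≤ M

lemma exists_bounds (hΛ : 0 < Λ) : ∃ M, Bounds Λ M := by
  obtain ⟨M1, -, h1⟩ := exists_bound_deriv_step Λ
  obtain ⟨M2, h2⟩ := exists_bound_saw
  have a1 : M1 ≤ max (max M1 M2) (max 1 (1 / Λ)) := (le_max_left _ _).trans (le_max_left _ _)
  have a2 : M2 ≤ max (max M1 M2) (max 1 (1 / Λ)) := (le_max_right _ _).trans (le_max_left _ _)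
  have a3 : 1 ≤ max (max M1 M2) (max 1 (1 / Λ)) := (le_max_left _ _).trans (le_max_right _ _)
  have a4 : 1 / Λ ≤ max (max M1 M2) (max 1 (1 / Λ)) :=
    (le_max_right _ _).trans (le_max_right _ _)
  refine ⟨max (max M1 M2) (max 1 (1 / Λ)), a3, ?_, ?_, fun θ => (h2 θ).1.trans a2,
    fun θ => (h2 θ).2.1.trans a2, fun θ => (h2 θ).2.2.trans a2, ?_⟩
  · intro k i s hk hy
    exact (h1 k i s hk hy).1.trans (by gcongr)
  · intro k i s hk hy
    exact (h1 k i s hk hy).2.trans (by gcongr)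
  · intro k s hk hy1 hy2
    exact (abs_sub_balance_mul_le hΛ hk hy1 hy2).trans a4

lemma freq_le (hk : 1 ≤ k) : freq k ≤ 4 * k ^ 2 := by
  have hk1 : (1 : ℝ) ≤ k := by exact_mod_cast hk
  unfold freq; nlinarith

lemma gap_le (hk : 1 ≤ k) : gap k ≤ 5 * k := by
  have hk1 : (1 : ℝ) ≤ k := by exact_mod_cast hk
  unfold gap; linarith

lemma zeros_le (hk : 1 ≤ k) : zeros k ≤ 13 * k ^ 2 := by
  have hk1 : (1 : ℝ) ≤ k := by exact_mod_cast hk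
  unfold zeros freq; push_cast; nlinarith

lemma abs_phase_le {M : ℝ} (hM : Bounds Λ M) (hk : 1 ≤ k) (φ : ℝ) : |phase k φ| ≤ M := by
  have h1 := two_mul_gap_div_zeros_le hk
  have h0 : 0 ≤ 2 * gap k / zeros k :=
    div_nonneg (by linarith [gap_pos k]) (zeros_pos k).le
  have h2 := hM.saw (sgn k * zeros k * φ)
  unfold phase
  rw [abs_mul, abs_of_nonneg h0]
  nlinarith [abs_nonneg (saw (sgn k * zeros k * φ)), hM.one_le]

lemma abs_deriv_logAmp_add_freq_le {M : ℝ} (hM : Bounds Λ M) (hk : 1 ≤ k)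
    (h1 : k ≤ exp (Λ * s)) (h2 : exp (Λ * s) ≤ k + 1) :
    |deriv (logAmp Λ k) s + freq k| ≤ 15 * M ^ 2 * k := by
  have hk1 : (1 : ℝ) ≤ k := by exact_mod_cast hk
  have hM1 := hM.one_le
  have hd := gap_le hk
  have hd0 := gap_pos k
  have hg0 := step_nonneg (Λ := Λ) (k := k) (i := 5) (s := s)
  have hg1 := step_le_one (Λ := Λ) (k := k) (i := 5) (s := s)
  have e1 : |gap k * (1 - 2 * step Λ k 5 s)| ≤ 5 * k := by
    rw [abs_mul, abs_of_pos hd0]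
    have : |1 - 2 * step Λ k 5 s| ≤ 1 := abs_le.2 ⟨by linarith, by linarith⟩
    nlinarith [abs_nonneg (1 - 2 * step Λ k 5 s)]
  have e2 : |deriv (step Λ k 5) s * (s - balance Λ k)| ≤ M ^ 2 := by
    rw [abs_mul]
    have a := hM.deriv_step k 5 s hk h2
    have b := hM.balance k s hk h1 h2
    calc _ ≤ M * k * |s - balance Λ k| := by gcongr
      _ = M * (|s - balance Λ k| * k) := by ring
      _ ≤ M * M := by gcongr
      _ = M ^ 2 := by ring
  have e3 : |2 * gap k * (deriv (step Λ k 5) s * (s - balance Λ k))| ≤ 2 * (5 * k) * M ^ 2 := by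
    rw [abs_mul, abs_of_pos (by linarith)]
    gcongr
  rw [deriv_logAmp]
  calc _ = |gap k * (1 - 2 * step Λ k 5 s) -
        2 * gap k * (deriv (step Λ k 5) s * (s - balance Λ k))| := by congr 1; ring
    _ ≤ 5 * k + 2 * (5 * k) * M ^ 2 := (abs_sub _ _).trans (add_le_add e1 e3)
    _ ≤ _ := by nlinarith [mul_nonneg (by linarith : (0 : ℝ) ≤ k) (by nlinarith : 0 ≤ M ^ 2 - 1)]

lemma abs_deriv_deriv_logAmp_le {M : ℝ} (hM : Bounds Λ M) (hk : 1 ≤ k)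
    (h1 : k ≤ exp (Λ * s)) (h2 : exp (Λ * s) ≤ k + 1) :
    |deriv (deriv (logAmp Λ k)) s| ≤ 30 * M ^ 2 * k ^ 2 := by
  have hk1 : (1 : ℝ) ≤ k := by exact_mod_cast hk
  have hM1 := hM.one_le
  have hd := gap_le hk
  have hd0 := gap_pos k
  have e1 : |4 * gap k * deriv (step Λ k 5) s| ≤ 4 * (5 * k) * (M * k) := by
    rw [abs_mul, abs_of_pos (by linarith)]
    have := hM.deriv_step k 5 s hk h2
    gcongr
  have e2 : |deriv (deriv (step Λ k 5)) s * (s - balance Λ k)| ≤ M ^ 2 * k := by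
    rw [abs_mul]
    have a := hM.deriv_deriv_step k 5 s hk h2
    have b := hM.balance k s hk h1 h2
    calc _ ≤ M * k ^ 2 * |s - balance Λ k| := by gcongr
      _ = M * k * (|s - balance Λ k| * k) := by ring
      _ ≤ M * k * M := by gcongr
      _ = M ^ 2 * k := by ring
  have e3 : |2 * gap k * (deriv (deriv (step Λ k 5)) s * (s - balance Λ k))| ≤
      2 * (5 * k) * (M ^ 2 * k) := by
    rw [abs_mul, abs_of_pos (by linarith)]
    gcongr
  rw [deriv_deriv_logAmp]
  calc _ = |-(4 * gap k * deriv (step Λ k 5) s) -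
        2 * gap k * (deriv (deriv (step Λ k 5)) s * (s - balance Λ k))| := by congr 1; ring
    _ ≤ 4 * (5 * k) * (M * k) + 2 * (5 * k) * (M ^ 2 * k) := by
      refine (abs_sub _ _).trans (add_le_add ?_ e3)
      rwa [abs_neg]
    _ ≤ _ := by nlinarith [mul_nonneg (sq_nonneg (k : ℝ)) (by nlinarith : 0 ≤ M ^ 2 - M)]

lemma norm_waveSymbol_le {M : ℝ} (hM : Bounds Λ M) (hk : 1 ≤ k)
    (h1 : k ≤ exp (Λ * w.re)) (h2 : exp (Λ * w.re) ≤ k + 1) :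
    ‖waveSymbol (logAmp Λ k) (fun s => 1 - step Λ k 5 s) (phase k)
      (sgn k * freq (k + 1)) w‖ ≤ 1000 * M ^ 4 * k ^ 3 := by
  have hk1 : (1 : ℝ) ≤ k := by exact_mod_cast hk
  have hM1 := hM.one_le
  have hd := gap_le hk
  have hd0 := gap_pos k
  have hn := freq_le hk
  have hn0 := freq_pos k
  have hN := zeros_le hk
  have hN0 := zeros_pos k
  have hg0 := step_nonneg (Λ := Λ) (k := k) (i := 5) (s := w.re)
  have hg1 := step_le_one (Λ := Λ) (k := k) (i := 5) (s := w.re)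
  have hg : |1 - step Λ k 5 w.re| ≤ 1 := abs_le.2 ⟨by linarith, by linarith⟩
  have hp := abs_phase_le hM hk w.im
  have ea := abs_deriv_deriv_logAmp_le hM hk h1 h2
  have eb : |deriv (deriv (step Λ k 5)) w.re * phase k w.im| ≤ M * k ^ 2 * M := by
    rw [abs_mul]
    have := hM.deriv_deriv_step k 5 w.re hk h2
    gcongr
  have ec : |(1 - step Λ k 5 w.re) * deriv (deriv (phase k)) w.im| ≤
      1 * (2 * (5 * k) * (13 * k ^ 2) * M) := by
    rw [deriv_deriv_phase, abs_mul, abs_mul, abs_of_pos (by positivity : 0 < 2 * gap k * zeros k)]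
    have := hM.deriv_deriv_saw (sgn k * zeros k * w.im)
    gcongr
  have ex := abs_deriv_logAmp_add_freq_le hM hk h1 h2
  have ez : |deriv (step Λ k 5) w.re * phase k w.im| ≤ M * k * M := by
    rw [abs_mul]
    have := hM.deriv_step k 5 w.re hk h2
    gcongr
  have ey : |gap k + (1 - step Λ k 5 w.re) * (2 * gap k *
      deriv saw (sgn k * zeros k * w.im))| ≤ 5 * k + 1 * (2 * (5 * k) * M) := by
    refine (abs_add_le _ _).trans (add_le_add (by rwa [abs_of_pos hd0]) ?_)
    rw [abs_mul, abs_mul, abs_of_pos (by positivity : 0 < 2 * gap k)]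
    have := hM.deriv_saw (sgn k * zeros k * w.im)
    gcongr
  rw [waveSymbol_eq]
  generalize hx : deriv (logAmp Λ k) w.re + freq k = x at ex
  rw [← eq_sub_iff_add_eq] at hx
  rw [hx]
  generalize deriv (deriv (logAmp Λ k)) w.re = a at *
  generalize deriv (deriv (step Λ k 5)) w.re * phase k w.im = b at *
  generalize (1 - step Λ k 5 w.re) * deriv (deriv (phase k)) w.im = c at *
  generalize deriv (step Λ k 5) w.re * phase k w.im = z at *
  generalize gap k + (1 - step Λ k 5 w.re) * (2 * gap k *
      deriv saw (sgn k * zeros k * w.im)) = y at *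
  generalize freq k = n at *
  have split : ((a : ℝ) : ℂ) - b * Complex.I + c * Complex.I +
      (((x - n : ℝ) : ℂ) - z * Complex.I) ^ 2 - ((n + y : ℝ) : ℂ) ^ 2 =
      a - b * Complex.I + c * Complex.I + ((x : ℂ) - z * Complex.I) ^ 2
        - 2 * n * (x - z * Complex.I) - 2 * n * y - y ^ 2 := by push_cast; ring
  have hxz : ‖(x : ℂ) - z * Complex.I‖ ≤ |x| + |z| := by
    refine (norm_sub_le _ _).trans ?_
    simp
  have hxz2 : |x| + |z| ≤ 16 * M ^ 2 * k := by nlinarith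
  have hy2 : |y| ≤ 15 * M ^ 2 * k := by
    refine ey.trans ?_
    nlinarith [mul_nonneg (by linarith : (0 : ℝ) ≤ k) (by nlinarith : 0 ≤ M ^ 2 - M),
      mul_nonneg (by linarith : (0 : ℝ) ≤ k) (by nlinarith : 0 ≤ M ^ 2 - 1)]
  have hM2 : M ≤ M ^ 4 := le_self_pow₀ hM1 (by norm_num)
  have hM24 : M ^ 2 ≤ M ^ 4 := pow_le_pow_right₀ hM1 (by norm_num)
  have hk23 : (k : ℝ) ^ 2 ≤ k ^ 3 := pow_le_pow_right₀ hk1 (by norm_num)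
  rw [split]
  calc _ ≤ |a| + |b| + |c| + (|x| + |z|) ^ 2 + 2 * n * (|x| + |z|) + 2 * n * |y| + |y| ^ 2 := by
        refine (norm_sub_le _ _).trans (add_le_add ?_ (by simp))
        refine (norm_sub_le _ _).trans (add_le_add ?_ (by simp [abs_of_pos hn0]))
        refine (norm_sub_le _ _).trans (add_le_add ?_ ?_)
        · refine (norm_add_le _ _).trans (add_le_add ?_ ?_)
          · refine (norm_add_le _ _).trans (add_le_add ?_ (by simp))
            refine (norm_sub_le _ _).trans (add_le_add (by simp) (by simp))
          · rw [norm_pow]; gcongr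
        · rw [norm_mul]
          have : ‖(2 * n : ℂ)‖ = 2 * n := by simp [abs_of_pos hn0]
          rw [this]; gcongr
    _ ≤ 30 * M ^ 2 * k ^ 2 + M * k ^ 2 * M + 1 * (2 * (5 * k) * (13 * k ^ 2) * M) +
        (16 * M ^ 2 * k) ^ 2 + 2 * (4 * k ^ 2) * (16 * M ^ 2 * k) +
        2 * (4 * k ^ 2) * (15 * M ^ 2 * k) + (15 * M ^ 2 * k) ^ 2 := by gcongr
    _ = 31 * (M ^ 2 * k ^ 2) + 130 * (M * k ^ 3) + 481 * (M ^ 4 * k ^ 2) +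
        248 * (M ^ 2 * k ^ 3) := by ring
    _ ≤ 31 * (M ^ 4 * k ^ 3) + 130 * (M ^ 4 * k ^ 3) + 481 * (M ^ 4 * k ^ 3) +
        248 * (M ^ 4 * k ^ 3) := by gcongr
    _ ≤ _ := by
      have : 0 ≤ M ^ 4 * (k : ℝ) ^ 3 := by positivity
      linarith

lemma norm_lap_block_le {M : ℝ} (hM : Bounds Λ M) (hk : 1 ≤ k)
    (h1 : k ≤ exp (Λ * w.re)) (h2 : exp (Λ * w.re) ≤ k + 1) :
    ‖lap (block Λ k) w‖ ≤
      1100 * M ^ 4 * k ^ 3 * (exp (-freq k * w.re) + exp (logAmp Λ k w.re)) := by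
  have hk1 : (1 : ℝ) ≤ k := by exact_mod_cast hk
  have hM1 := hM.one_le
  have hn := freq_le hk
  have hn0 := freq_pos k
  have hM14 : M ≤ M ^ 4 := le_self_pow₀ hM1 (by norm_num)
  have hM34 : M ^ 3 ≤ M ^ 4 := pow_le_pow_right₀ hM1 (by norm_num)
  have hk23 : (k : ℝ) ^ 2 ≤ k ^ 3 := pow_le_pow_right₀ hk1 (by norm_num)
  have hMk : 0 ≤ M ^ 4 * (k : ℝ) ^ 3 := by positivity
  have eIn : ‖lap (waveIn Λ k) w‖ ≤ 1100 * M ^ 4 * k ^ 3 * exp (-freq k * w.re) := by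
    rw [lap_waveIn, norm_mul, Complex.norm_real, norm_eq_abs]
    have : ‖Complex.exp ((-freq k * w.re : ℝ) +
        (-(sgn k * freq k) * w.im + 0 * 0 : ℝ) * Complex.I)‖ = exp (-freq k * w.re) := by
      rw [Complex.norm_exp]; simp
    rw [this]
    gcongr
    have a1 := hM.deriv_step k 4 w.re hk h2
    have a2 := hM.deriv_deriv_step k 4 w.re hk h2
    calc _ ≤ |deriv (deriv (step Λ k 4)) w.re| + 2 * freq k * |deriv (step Λ k 4) w.re| := by
          refine (abs_add_le _ _).trans (add_le_add (by rw [abs_neg]) ?_)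
          rw [abs_mul, abs_of_pos (by positivity)]
      _ ≤ M * k ^ 2 + 2 * (4 * k ^ 2) * (M * k) := by gcongr
      _ = M * k ^ 2 + 8 * (M * k ^ 3) := by ring
      _ ≤ M ^ 4 * k ^ 3 + 8 * (M ^ 4 * k ^ 3) := by gcongr
      _ ≤ _ := by linarith
  have eOut : ‖lap (waveOut Λ k) w‖ ≤ 1100 * M ^ 4 * k ^ 3 * exp (logAmp Λ k w.re) := by
    rw [lap_waveOut, norm_mul]
    have : ‖Complex.exp (logAmp Λ k w.re + (sgn k * freq (k + 1) * w.im +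
      (1 - step Λ k 5 w.re) * phase k w.im : ℝ) * Complex.I)‖ = exp (logAmp Λ k w.re) := by
      rw [Complex.norm_exp]; simp
    rw [this]
    gcongr
    have a1 := hM.deriv_step k 1 w.re hk h2
    have a2 := hM.deriv_deriv_step k 1 w.re hk h2
    have a3 := norm_waveSymbol_le hM hk h1 h2
    have a4 : ‖((deriv (logAmp Λ k) w.re : ℝ) : ℂ) +
        (deriv (fun s => 1 - step Λ k 5 s) w.re * phase k w.im : ℝ) * Complex.I‖ ≤
        15 * M ^ 2 * k + 4 * k ^ 2 + M * k * M := by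
      refine (norm_add_le _ _).trans (add_le_add ?_ ?_)
      · rw [Complex.norm_real, norm_eq_abs]
        have := abs_deriv_logAmp_add_freq_le hM hk h1 h2
        calc _ = |(deriv (logAmp Λ k) w.re + freq k) - freq k| := by congr 1; ring
          _ ≤ |deriv (logAmp Λ k) w.re + freq k| + |freq k| := abs_sub _ _
          _ ≤ _ := add_le_add this (by rwa [abs_of_pos hn0])
      · rw [norm_mul, Complex.norm_I, mul_one, Complex.norm_real, norm_eq_abs, abs_mul,
          deriv_one_sub_step, abs_neg]
        have b1 := hM.deriv_step k 5 w.re hk h2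
        have b2 := abs_phase_le hM hk w.im
        gcongr
    have a5 : ‖(step Λ k 1 w.re : ℂ)‖ ≤ 1 := by
      rw [Complex.norm_real, norm_eq_abs, abs_of_nonneg step_nonneg]; exact step_le_one
    calc _ ≤ M * k ^ 2 + 2 * (M * k) * (15 * M ^ 2 * k + 4 * k ^ 2 + M * k * M) +
          1 * (1000 * M ^ 4 * k ^ 3) := by
          refine (norm_add_le _ _).trans (add_le_add ?_ ?_)
          · refine (norm_add_le _ _).trans (add_le_add (by simpa using a2) ?_)
            rw [norm_mul, norm_mul, Complex.norm_real, norm_eq_abs, Complex.norm_two]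
            gcongr
          · rw [norm_mul]
            gcongr
      _ = M * k ^ 2 + 32 * (M ^ 3 * k ^ 2) + 8 * (M * k ^ 3) + 1000 * (M ^ 4 * k ^ 3) := by ring
      _ ≤ M ^ 4 * k ^ 3 + 32 * (M ^ 4 * k ^ 3) + 8 * (M ^ 4 * k ^ 3) +
          1000 * (M ^ 4 * k ^ 3) := by gcongr
      _ ≤ _ := by linarith
  have : lap (block Λ k) w = lap (waveIn Λ k) w - lap (waveOut Λ k) w :=
    lap_sub contDiff_waveIn contDiff_waveOut w
  rw [this, mul_add]
  exact (norm_sub_le _ _).trans (add_le_add eIn eOut)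

end estimates

lemma norm_exp_sub_exp_ge {a b α β η : ℝ} (hη : cos (β - α) ≤ 1 - η) :
    η / 2 * (exp a + exp b) ^ 2 ≤ ‖Complex.exp (a + α * Complex.I) -
      Complex.exp (b + β * Complex.I)‖ ^ 2 := by
  have h : ‖Complex.exp (a + α * Complex.I) - Complex.exp (b + β * Complex.I)‖ ^ 2 =
      exp a ^ 2 + exp b ^ 2 - 2 * (exp a * exp b) * cos (β - α) := by
    rw [Complex.sq_norm, Complex.normSq_apply, cos_sub]
    simp only [Complex.sub_re, Complex.sub_im, Complex.exp_re, Complex.exp_im, Complex.add_re,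
      Complex.add_im, Complex.ofReal_re, Complex.ofReal_im, Complex.mul_re, Complex.mul_im,
      Complex.I_re, Complex.I_im, mul_zero, mul_one, sub_zero, add_zero, zero_add]
    linear_combination exp a ^ 2 * sin_sq_add_cos_sq α + exp b ^ 2 * sin_sq_add_cos_sq β
  have hη2 : η ≤ 2 := by linarith [neg_one_le_cos (β - α)]
  rw [h]
  nlinarith [mul_le_mul_of_nonneg_left hη (mul_pos (exp_pos a) (exp_pos b)).le,
    mul_nonneg (by linarith : 0 ≤ 1 - η / 2) (sq_nonneg (exp a - exp b))]

section

variable {Λ : ℝ} {k : ℕ} {w : ℂ}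

lemma norm_waveIn : ‖waveIn Λ k w‖ = (1 - step Λ k 4 w.re) * exp (-freq k * w.re) := by
  rw [waveIn, norm_wave, abs_of_nonneg (sub_nonneg.2 step_le_one)]

lemma norm_waveOut : ‖waveOut Λ k w‖ = step Λ k 1 w.re * exp (logAmp Λ k w.re) := by
  rw [waveOut, norm_wave, abs_of_nonneg step_nonneg]

lemma abs_logAmp_add_le (hΛ : 0 < Λ) (hk : 1 ≤ k) (h1 : k ≤ exp (Λ * w.re))
    (h2 : exp (Λ * w.re) ≤ k + 1) : |logAmp Λ k w.re - -freq k * w.re| ≤ 5 / Λ := by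
  have hb := abs_sub_balance_mul_le hΛ hk h1 h2
  have hg0 := step_nonneg (Λ := Λ) (k := k) (i := 5) (s := w.re)
  have hg1 := step_le_one (Λ := Λ) (k := k) (i := 5) (s := w.re)
  have hg : |1 - 2 * step Λ k 5 w.re| ≤ 1 := abs_le.2 ⟨by linarith, by linarith⟩
  have hd := gap_le hk
  have hd0 := gap_pos k
  unfold logAmp
  rw [add_sub_cancel_left, abs_mul, abs_mul, abs_of_pos hd0]
  calc _ ≤ 5 * k * 1 * |w.re - balance Λ k| := by gcongr
    _ = 5 * (|w.re - balance Λ k| * k) := by ring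
    _ ≤ 5 * (1 / Λ) := by gcongr
    _ = _ := by ring

lemma exp_logAmp_le (hΛ : 0 < Λ) (hk : 1 ≤ k) (h1 : k ≤ exp (Λ * w.re))
    (h2 : exp (Λ * w.re) ≤ k + 1) :
    exp (logAmp Λ k w.re) ≤ exp (5 / Λ) * exp (-freq k * w.re) := by
  rw [← exp_add, exp_le_exp]
  linarith [(abs_le.1 (abs_logAmp_add_le hΛ hk h1 h2)).2]

lemma exp_freq_le (hΛ : 0 < Λ) (hk : 1 ≤ k) (h1 : k ≤ exp (Λ * w.re))
    (h2 : exp (Λ * w.re) ≤ k + 1) :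
    exp (-freq k * w.re) ≤ exp (5 / Λ) * exp (logAmp Λ k w.re) := by
  rw [← exp_add, exp_le_exp]
  linarith [(abs_le.1 (abs_logAmp_add_le hΛ hk h1 h2)).1]

/-- In the inner quarter of an annulus the incoming wave dominates. -/
lemma norm_block_ge_of_inner (hΛ : 0 < Λ) (h : exp (Λ * w.re) - k ≤ 1 / 4) :
    (1 - exp (-(1 / (4 * Λ)))) / 2 * (exp (-freq k * w.re) + exp (logAmp Λ k w.re)) ≤
      ‖block Λ k w‖ := by
  have hk0 : (0 : ℝ) ≤ k := by positivity
  have e4 := step_eq_zero (Λ := Λ) (k := k) (s := w.re) (i := 4) (by linarith)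
  have e5 := step_eq_zero (Λ := Λ) (k := k) (s := w.re) (i := 5) (by linarith)
  have hs : gap k * (w.re - balance Λ k) ≤ -(1 / (4 * Λ)) := by
    have a := mul_sub_balance_le (k := k) (s := w.re) hΛ
    have b : (exp (Λ * w.re) - (k + 3 / 8)) / (k + 3 / 8) ≤ -(1 / 8) / (k + 3 / 8) := by
      gcongr; linarith
    have c := mul_le_mul_of_nonneg_left (a.trans b) (gap_pos k).le
    have d : gap k * (-(1 / 8) / (k + 3 / 8)) ≤ -(1 / 4) := by
      rw [mul_div_assoc', div_le_iff₀ (by positivity)]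
      unfold gap; linarith
    have e : Λ * (gap k * (w.re - balance Λ k)) ≤ Λ * (-(1 / (4 * Λ))) := by
      have : Λ * (-(1 / (4 * Λ))) = -(1 / 4) := by field_simp
      rw [this]; linarith
    exact le_of_mul_le_mul_left e hΛ
  have hle : exp (logAmp Λ k w.re) ≤ exp (-(1 / (4 * Λ))) * exp (-freq k * w.re) := by
    rw [← exp_add, exp_le_exp, logAmp, e5]; linarith
  have hq : exp (-(1 / (4 * Λ))) ≤ 1 := exp_le_one_iff.2 (by
    have : 0 < 1 / (4 * Λ) := by positivity
    linarith)
  have hn := norm_sub_norm_le (waveIn Λ k w) (waveOut Λ k w)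
  rw [norm_waveIn, norm_waveOut, e4] at hn
  have h1 := mul_le_mul_of_nonneg_right (step_le_one (Λ := Λ) (k := k) (i := 1) (s := w.re))
    (exp_pos (logAmp Λ k w.re)).le
  have hb : block Λ k w = waveIn Λ k w - waveOut Λ k w := rfl
  rw [hb]
  nlinarith [exp_pos (logAmp Λ k w.re), exp_pos (-freq k * w.re),
    mul_nonneg (sub_nonneg.2 hq) (sub_nonneg.2 hle), exp_pos (-(1 / (4 * Λ))),
    mul_nonneg (sub_nonneg.2 hq) (exp_pos (-freq k * w.re)).le]

lemma norm_block_ge_of_outer (hΛ : 0 < Λ) (h : 1 / 2 ≤ exp (Λ * w.re) - k)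
    (h' : exp (Λ * w.re) - k ≤ 5 / 8) :
    (1 - exp (-(1 / (4 * Λ)))) / 2 * (exp (-freq k * w.re) + exp (logAmp Λ k w.re)) ≤
      ‖block Λ k w‖ := by
  have hk0 : (0 : ℝ) ≤ k := by positivity
  have e1 := step_eq_one (Λ := Λ) (k := k) (s := w.re) (i := 1) (by linarith)
  have e5 := step_eq_zero (Λ := Λ) (k := k) (s := w.re) (i := 5) (by linarith)
  have hs : 1 / (4 * Λ) ≤ gap k * (w.re - balance Λ k) := by
    have a := le_mul_sub_balance (k := k) (s := w.re) hΛ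
    have b : (1 / 8) / (k + 5 / 8) ≤ (exp (Λ * w.re) - (k + 3 / 8)) / exp (Λ * w.re) := by
      gcongr <;> linarith
    have c := mul_le_mul_of_nonneg_left (b.trans a) (gap_pos k).le
    have d : 1 / 4 ≤ gap k * ((1 / 8) / (k + 5 / 8)) := by
      rw [mul_div_assoc', le_div_iff₀ (by positivity)]
      unfold gap; linarith
    have e : Λ * (1 / (4 * Λ)) ≤ Λ * (gap k * (w.re - balance Λ k)) := by
      have : Λ * (1 / (4 * Λ)) = 1 / 4 := by field_simp
      rw [this]; linarith
    exact le_of_mul_le_mul_left e hΛ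
  have hle : exp (-freq k * w.re) ≤ exp (-(1 / (4 * Λ))) * exp (logAmp Λ k w.re) := by
    rw [← exp_add, exp_le_exp, logAmp, e5]; linarith
  have hq : exp (-(1 / (4 * Λ))) ≤ 1 := exp_le_one_iff.2 (by
    have : 0 < 1 / (4 * Λ) := by positivity
    linarith)
  have hn := norm_sub_norm_le (waveOut Λ k w) (waveIn Λ k w)
  rw [norm_waveIn, norm_waveOut, e1] at hn
  have h1 := mul_nonneg (step_nonneg (Λ := Λ) (k := k) (i := 4) (s := w.re))
    (exp_pos (-freq k * w.re)).le
  have hb : block Λ k w = waveIn Λ k w - waveOut Λ k w := rfl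
  rw [hb, norm_sub_rev]
  nlinarith [exp_pos (logAmp Λ k w.re), exp_pos (-freq k * w.re),
    mul_nonneg (sub_nonneg.2 hq) (sub_nonneg.2 hle), exp_pos (-(1 / (4 * Λ))),
    mul_nonneg (sub_nonneg.2 hq) (exp_pos (logAmp Λ k w.re)).le]

lemma norm_block_ge_of_outermost (hΛ : 0 < Λ) (hk : 1 ≤ k) (h : 5 / 8 ≤ exp (Λ * w.re) - k)
    (h' : exp (Λ * w.re) ≤ k + 1) :
    1 / (1 + exp (5 / Λ)) * (exp (-freq k * w.re) + exp (logAmp Λ k w.re)) ≤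
      ‖block Λ k w‖ := by
  have e1 := step_eq_one (Λ := Λ) (k := k) (s := w.re) (i := 1) (by linarith)
  have e4 := step_eq_one (Λ := Λ) (k := k) (s := w.re) (i := 4) (by linarith)
  have h0 : waveIn Λ k w = 0 := by
    rw [← norm_eq_zero, norm_waveIn, e4]; ring
  have hn : ‖block Λ k w‖ = exp (logAmp Λ k w.re) := by
    rw [block, h0, zero_sub, norm_neg, norm_waveOut, e1, one_mul]
  have := exp_freq_le hΛ hk (by linarith) h'
  rw [hn, div_mul_eq_mul_div, div_le_iff₀ (by positivity)]
  linarith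

/-- In the middle of an annulus, away from the zeros, the two waves do not cancel. -/
lemma norm_block_ge_of_middle (hk : 1 ≤ k) (h1 : 1 / 4 ≤ exp (Λ * w.re) - k)
    (h2 : exp (Λ * w.re) - k ≤ 1 / 2) (h3 : cos (sgn k * zeros k * w.im) ≤ 1 / 2) :
    √((1 - cos (π / 13)) / 2) * (exp (-freq k * w.re) + exp (logAmp Λ k w.re)) ≤
      ‖block Λ k w‖ := by
  have e1 := step_eq_one (Λ := Λ) (k := k) (s := w.re) (i := 1) (by linarith)
  have e4 := step_eq_zero (Λ := Λ) (k := k) (s := w.re) (i := 4) (by linarith)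
  have e5 := step_eq_zero (Λ := Λ) (k := k) (s := w.re) (i := 5) (by linarith)
  have h0 : 0 ≤ 2 * gap k / zeros k :=
    div_nonneg (by linarith [gap_pos k]) (zeros_pos k).le
  have hc := cos_add_mul_saw_le h3 h0 (two_mul_gap_div_zeros_le hk)
  have hb : block Λ k w = Complex.exp ((-freq k * w.re : ℝ) +
      (-(sgn k * freq k) * w.im : ℝ) * Complex.I) -
      Complex.exp ((logAmp Λ k w.re : ℝ) +
        (sgn k * freq (k + 1) * w.im + phase k w.im : ℝ) * Complex.I) := by
    simp only [block, waveIn, waveOut, wave, e1, e4, e5]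
    simp
  have hη : cos ((sgn k * freq (k + 1) * w.im + phase k w.im) - (-(sgn k * freq k) * w.im)) ≤
      1 - (1 - cos (π / 13)) := by
    have : (sgn k * freq (k + 1) * w.im + phase k w.im) - (-(sgn k * freq k) * w.im) =
        sgn k * zeros k * w.im + 2 * gap k / zeros k * saw (sgn k * zeros k * w.im) := by
      rw [phase, zeros]; ring
    rw [this]; linarith
  have h := norm_exp_sub_exp_ge (a := -freq k * w.re) (b := logAmp Λ k w.re) hη
  rw [← hb] at h
  have h4 := abs_le_abs_of_nonneg (sqrt_nonneg _) (sqrt_le_sqrt h)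
  rw [sqrt_sq (norm_nonneg _), sqrt_mul' _ (sq_nonneg _), sqrt_sq (by positivity)] at h4
  rwa [abs_of_nonneg (by positivity), abs_of_nonneg (norm_nonneg _)] at h4

lemma exists_norm_block_ge (hΛ : 0 < Λ) : ∃ c : ℝ, 0 < c ∧ ∀ (k : ℕ) (w : ℂ), 1 ≤ k →
    k ≤ exp (Λ * w.re) → exp (Λ * w.re) ≤ k + 1 →
    c * (exp (-freq k * w.re) + exp (logAmp Λ k w.re)) ≤ ‖block Λ k w‖ ∨
    (1 / 4 < exp (Λ * w.re) - k ∧ exp (Λ * w.re) - k < 1 / 2 ∧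
      1 / 2 < cos (sgn k * zeros k * w.im)) := by
  have p1 : 0 < (1 - exp (-(1 / (4 * Λ)))) / 2 := by
    have : exp (-(1 / (4 * Λ))) < 1 :=
      (exp_lt_exp.2 (neg_neg_of_pos (by positivity))).trans_eq exp_zero
    linarith
  have p2 : 0 < 1 / (1 + exp (5 / Λ)) := by positivity
  have p3 : 0 < √((1 - cos (π / 13)) / 2) := by
    have : cos (π / 13) < cos 0 :=
      cos_lt_cos_of_nonneg_of_le_pi le_rfl (by linarith [pi_pos]) (by positivity)
    rw [cos_zero] at this
    exact sqrt_pos.2 (by linarith)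
  refine ⟨_, lt_min (lt_min p1 p2) p3, fun k w hk h1 h2 => ?_⟩
  have hE : 0 ≤ exp (-freq k * w.re) + exp (logAmp Λ k w.re) := by positivity
  by_cases a : exp (Λ * w.re) - k ≤ 1 / 4
  · left
    refine le_trans ?_ (norm_block_ge_of_inner hΛ a)
    exact mul_le_mul_of_nonneg_right ((min_le_left _ _).trans (min_le_left _ _)) hE
  by_cases b : 5 / 8 ≤ exp (Λ * w.re) - k
  · left
    refine le_trans ?_ (norm_block_ge_of_outermost hΛ hk b h2)
    exact mul_le_mul_of_nonneg_right ((min_le_left _ _).trans (min_le_right _ _)) hE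
  by_cases c : 1 / 2 ≤ exp (Λ * w.re) - k
  · left
    refine le_trans ?_ (norm_block_ge_of_outer hΛ c (not_le.1 b).le)
    exact mul_le_mul_of_nonneg_right ((min_le_left _ _).trans (min_le_left _ _)) hE
  by_cases d : cos (sgn k * zeros k * w.im) ≤ 1 / 2
  · left
    refine le_trans ?_ (norm_block_ge_of_middle hk (not_le.1 a).le (not_le.1 c).le d)
    exact mul_le_mul_of_nonneg_right (min_le_right _ _) hE
  · exact Or.inr ⟨not_le.1 a, not_le.1 c, not_le.1 d⟩

end

section

variable {Λ : ℝ} {k : ℕ} {w : ℂ}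

lemma sgn_succ (k : ℕ) : sgn (k + 1) = -sgn k := by
  unfold sgn; rw [pow_succ]; ring

lemma block_eq_of_le (h : exp (Λ * w.re) - k ≤ 1 / 8) : block Λ k w =
    Complex.exp ((-freq k * w.re : ℝ) + (-(sgn k * freq k) * w.im : ℝ) * Complex.I) := by
  have e1 := step_eq_zero (Λ := Λ) (k := k) (s := w.re) (i := 1) (by linarith)
  have e4 := step_eq_zero (Λ := Λ) (k := k) (s := w.re) (i := 4) (by linarith)
  simp [block, waveIn, waveOut, wave, e1, e4]

lemma block_eq_of_ge (h : 3 / 4 ≤ exp (Λ * w.re) - k) : block Λ k w =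
    -(exp (gap k * balance Λ k) : ℝ) * Complex.exp ((-freq (k + 1) * w.re : ℝ) +
      (sgn k * freq (k + 1) * w.im : ℝ) * Complex.I) := by
  have e1 := step_eq_one (Λ := Λ) (k := k) (s := w.re) (i := 1) (by linarith)
  have e4 := step_eq_one (Λ := Λ) (k := k) (s := w.re) (i := 4) (by linarith)
  have e5 := step_eq_one (Λ := Λ) (k := k) (s := w.re) (i := 5) (by linarith)
  simp only [block, waveIn, waveOut, wave, e1, e4, e5, logAmp, sub_self, Complex.ofReal_zero,
    zero_mul, zero_sub, Complex.ofReal_one, one_mul, add_zero, Complex.ofReal_exp, neg_mul,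
    ← Complex.exp_add, freq_succ]
  congr 2
  push_cast
  ring

/-- The coefficients matching consecutive blocks. -/
noncomputable def coef (Λ : ℝ) : ℕ → ℝ
  | 0 => 1
  | k + 1 => -coef Λ k * exp (gap (k + 1) * balance Λ (k + 1))

/-- The solution in the `k`-th annulus; the `0`-th annulus is a punctured disc. -/
noncomputable def piece (Λ : ℝ) : ℕ → ℂ → ℂ
  | 0 => wave (fun _ => 1) (fun s => 4 * (1 - 2 * step Λ 0 5 s) * s) (fun _ => 0) (fun _ => 0) 4
  | k + 1 => fun w => coef Λ k * block Λ (k + 1) w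

lemma coef_ne_zero : coef Λ k ≠ 0 := by
  induction k with
  | zero => simp [coef]
  | succ k ih => simpa [coef] using ih

lemma contDiff_piece : ContDiff ℝ 2 (piece Λ k) := by
  cases k with
  | zero =>
    have := contDiff_step (Λ := Λ) (k := 0) (i := 5)
    have hA : ContDiff ℝ 2 fun s => 4 * (1 - 2 * step Λ 0 5 s) * s := by fun_prop
    unfold piece
    exact contDiff_wave contDiff_const hA contDiff_const contDiff_const
  | succ k =>
    unfold piece
    exact contDiff_const.mul contDiff_block

lemma piece_zero_ne_zero : piece Λ 0 w ≠ 0 := by simp [piece, wave]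

lemma piece_zero_eq_of_le (h : exp (Λ * w.re) ≤ 5 / 8) : piece Λ 0 w = Complex.exp (4 * w) := by
  have e5 := step_eq_zero (Λ := Λ) (k := 0) (s := w.re) (i := 5) (by simpa using h)
  simp only [piece, wave, e5]
  nth_rw 3 [← Complex.re_add_im w]
  push_cast
  ring_nf

lemma piece_eq_piece_succ (h1 : 3 / 4 ≤ exp (Λ * w.re) - k)
    (h2 : exp (Λ * w.re) - k ≤ 9 / 8) : piece Λ k w = piece Λ (k + 1) w := by
  have h := block_eq_of_le (Λ := Λ) (k := k + 1) (w := w) (by push_cast; linarith)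
  cases k with
  | zero =>
    have e5 := step_eq_one (Λ := Λ) (k := 0) (s := w.re) (i := 5) (by linarith)
    simp only [piece, h, wave, e5, coef, freq, sgn]
    push_cast
    ring_nf
  | succ k =>
    simp only [piece, h, block_eq_of_ge h1, coef, sgn_succ]
    push_cast
    ring_nf

lemma exists_int_freq (k : ℕ) : ∃ n : ℤ, sgn k * freq k = n :=
  ⟨(-1) ^ k * ((k : ℤ) + 1) ^ 2, by simp [sgn, freq]⟩

lemma wave_add_two_pi {ψ A χ Φ : ℝ → ℝ} {m : ℝ} {n : ℤ} (hm : m = n)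
    (hΦ : ∀ φ, Φ (φ + 2 * π) = Φ φ) :
    wave ψ A χ Φ m (w + 2 * π * Complex.I) = wave ψ A χ Φ m w := by
  have hre : (w + 2 * π * Complex.I).re = w.re := by simp
  have him : (w + 2 * π * Complex.I).im = w.im + 2 * π := by simp
  unfold wave
  rw [hre, him, hΦ, hm]
  congr 1
  rw [Complex.exp_eq_exp_iff_exists_int]
  refine ⟨n, ?_⟩
  push_cast
  ring

lemma piece_add_two_pi : piece Λ k (w + 2 * π * Complex.I) = piece Λ k w := by
  cases k with
  | zero =>
    unfold piece
    exact wave_add_two_pi (n := 4) (by norm_num) fun _ => rfl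
  | succ k =>
    obtain ⟨a, ha⟩ := exists_int_freq (k + 1)
    obtain ⟨b, hb⟩ := exists_int_freq (k + 1 + 1)
    rw [sgn_succ] at hb
    have e1 : waveIn Λ (k + 1) (w + 2 * π * Complex.I) = waveIn Λ (k + 1) w :=
      wave_add_two_pi (n := -a) (by rw [ha]; simp) fun _ => rfl
    have e2 : waveOut Λ (k + 1) (w + 2 * π * Complex.I) = waveOut Λ (k + 1) w := by
      refine wave_add_two_pi (n := -b) (by push_cast; linarith) fun φ => ?_
      unfold phase
      rw [← saw_add_int_mul (sgn (k + 1) * zeros (k + 1) * φ) (a - b)]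
      congr 2
      unfold zeros
      push_cast
      linear_combination (2 * π) * (ha - hb)
    simp only [piece, block, e1, e2]

/-- The solution in logarithmic coordinates. -/
noncomputable def profile (Λ : ℝ) (w : ℂ) : ℂ := piece Λ ⌊exp (Λ * w.re)⌋₊ w

lemma profile_eventuallyEq (w : ℂ) :
    profile Λ =ᶠ[nhds w] piece Λ ⌊exp (Λ * w.re)⌋₊ := by
  set k := ⌊exp (Λ * w.re)⌋₊ with hk
  have hk1 : (k : ℝ) ≤ exp (Λ * w.re) := Nat.floor_le (exp_pos _).le
  have hk2 : exp (Λ * w.re) < k + 1 := Nat.lt_floor_add_one _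
  have hc : ContinuousAt (fun z : ℂ => exp (Λ * z.re)) w := by fun_prop
  filter_upwards [hc.eventually (lt_mem_nhds (a := (k : ℝ) - 1 / 4) (by linarith)),
    hc.eventually (gt_mem_nhds hk2)] with z h1 h2
  unfold profile
  by_cases h : (k : ℝ) ≤ exp (Λ * z.re)
  · rw [(Nat.floor_eq_iff (exp_pos _).le).2 ⟨h, h2⟩]
  · push Not at h
    obtain ⟨j, hj⟩ : ∃ j, k = j + 1 := Nat.exists_eq_succ_of_ne_zero (by
      rintro h0
      rw [h0] at h
      exact absurd h (by simpa using (exp_pos _).le))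
    rw [hj] at h h1 ⊢
    push_cast at h h1
    rw [(Nat.floor_eq_iff (exp_pos _).le).2 ⟨by linarith, h⟩]
    exact piece_eq_piece_succ (by linarith) (by linarith)

lemma contDiff_profile : ContDiff ℝ 2 (profile Λ) :=
  contDiff_iff_contDiffAt.2 fun w =>
    contDiff_piece.contDiffAt.congr_of_eventuallyEq (profile_eventuallyEq w)

lemma profile_periodic : Function.Periodic (profile Λ) (2 * π * Complex.I) := by
  intro w
  have hre : (w + 2 * π * Complex.I).re = w.re := by simp
  unfold profile
  rw [hre, piece_add_two_pi]

lemma profile_eq_of_le (h : exp (Λ * w.re) ≤ 5 / 8) : profile Λ w = Complex.exp (4 * w) := by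
  rw [profile, Nat.floor_eq_zero.2 (by linarith), piece_zero_eq_of_le h]

lemma profile_eq_coef_mul (h : ⌊exp (Λ * w.re)⌋₊ = k + 1) :
    profile Λ w = coef Λ k * block Λ (k + 1) w := by
  rw [profile, h, piece]

lemma lap_profile (h : ⌊exp (Λ * w.re)⌋₊ = k + 1) :
    lap (profile Λ) w = coef Λ k * lap (block Λ (k + 1)) w := by
  rw [lap_congr (profile_eventuallyEq w), h]
  exact lap_const_mul contDiff_block _ _

lemma exists_floor_eq_succ (h : 1 ≤ exp (Λ * w.re)) : ∃ k, ⌊exp (Λ * w.re)⌋₊ = k + 1 ∧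
    ((k + 1 : ℕ) : ℝ) ≤ exp (Λ * w.re) ∧ exp (Λ * w.re) < (k + 1 : ℕ) + 1 := by
  obtain ⟨k, hk⟩ := Nat.exists_eq_succ_of_ne_zero (Nat.floor_pos.2 h).ne'
  exact ⟨k, hk, (Nat.floor_eq_iff (exp_pos _).le).1 hk⟩

lemma exists_norm_lap_profile_le (hΛ : 0 < Λ) : ∃ C : ℝ, ∀ w : ℂ, 1 ≤ exp (Λ * w.re) →
    ‖lap (profile Λ) w‖ ≤ C * exp (Λ * w.re) ^ 3 * ‖profile Λ w‖ := by
  obtain ⟨M, hM⟩ := exists_bounds hΛ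
  obtain ⟨c, hc, hb⟩ := exists_norm_block_ge hΛ
  refine ⟨1100 * M ^ 4 / c, fun w hw => ?_⟩
  obtain ⟨k, hk, h1, h2⟩ := exists_floor_eq_succ hw
  rw [lap_profile hk, profile_eq_coef_mul hk, norm_mul, norm_mul, mul_left_comm]
  gcongr
  rcases hb (k + 1) w (by omega) h1 h2.le with h | ⟨h3, h4, h5⟩
  · refine (norm_lap_block_le hM (by omega) h1 h2.le).trans ?_
    calc _ ≤ 1100 * M ^ 4 * exp (Λ * w.re) ^ 3 * (‖block Λ (k + 1) w‖ / c) := by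
          have := (le_div_iff₀' hc).2 h
          gcongr
      _ = _ := by ring
  · rw [lap_block_eq_zero h3 h4 h5, norm_zero]
    positivity

lemma profile_ne_zero_or_lap_eq_zero (hΛ : 0 < Λ) (w : ℂ) :
    profile Λ w ≠ 0 ∨ ∀ᶠ z in nhds w, lap (profile Λ) z = 0 := by
  rcases lt_or_ge (exp (Λ * w.re)) 1 with hw | hw
  · left
    rw [profile, Nat.floor_eq_zero.2 hw]
    exact piece_zero_ne_zero
  obtain ⟨c, hc, hb⟩ := exists_norm_block_ge hΛ
  obtain ⟨k, hk, h1, h2⟩ := exists_floor_eq_succ hw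
  rcases hb (k + 1) w (by omega) h1 h2.le with h | ⟨h3, h4, h5⟩
  · left
    rw [profile_eq_coef_mul hk]
    refine mul_ne_zero (Complex.ofReal_ne_zero.2 coef_ne_zero) (norm_pos_iff.1 (h.trans_lt' ?_))
    positivity
  · right
    have hr : ContinuousAt (fun z : ℂ => exp (Λ * z.re) - (k + 1 : ℕ)) w := by fun_prop
    have hi : ContinuousAt (fun z : ℂ => cos (sgn (k + 1) * zeros (k + 1) * z.im)) w := by
      fun_prop
    filter_upwards [hr.eventually (lt_mem_nhds h3), hr.eventually (gt_mem_nhds h4),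
      hi.eventually (lt_mem_nhds h5)] with z z3 z4 z5
    have hz : ⌊exp (Λ * z.re)⌋₊ = k + 1 :=
      (Nat.floor_eq_iff (exp_pos _).le).2 ⟨by linarith, by linarith⟩
    rw [lap_profile hz, lap_block_eq_zero z3 z4 z5, mul_zero]

lemma profile_ne_zero (h : exp (Λ * w.re) = k + 1) : profile Λ w ≠ 0 := by
  have hk : ⌊exp (Λ * w.re)⌋₊ = k + 1 := by
    rw [h]
    exact_mod_cast Nat.floor_natCast (k + 1)
  rw [profile_eq_coef_mul hk, block_eq_of_le (by push_cast; linarith)]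
  exact mul_ne_zero (Complex.ofReal_ne_zero.2 coef_ne_zero) (Complex.exp_ne_zero _)

lemma abs_coef_le (hΛ : 0 < Λ) : |coef Λ k| ≤
    exp (freq (k + 1) * (log (k + 1) / Λ) - (((k : ℝ) + 1) ^ 2 - 1) / (2 * Λ)) := by
  induction k with
  | zero => simp [coef]
  | succ k ih =>
    rw [coef, abs_mul, abs_neg, abs_of_pos (exp_pos _)]
    refine (mul_le_mul_of_nonneg_right ih (exp_pos _).le).trans ?_
    rw [← exp_add, exp_le_exp]
    have hk : (0 : ℝ) ≤ k := by positivity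
    have hb : balance Λ (k + 1) ≤ log (k + 2) / Λ := by
      refine div_le_div_of_nonneg_right (log_le_log (by positivity) ?_) hΛ.le
      push_cast
      linarith
    have hl : log (k + 1) ≤ log (k + 2) - 1 / (k + 2) := by
      have := one_sub_inv_le_log_of_pos (x := ((k : ℝ) + 2) / (k + 1)) (by positivity)
      rw [log_div (by positivity) (by positivity)] at this
      have e : 1 - (((k : ℝ) + 2) / (k + 1))⁻¹ = 1 / (k + 2) := by field_simp; ring
      linarith
    have hl' : log (k + 1) / Λ ≤ (log (k + 2) - 1 / (k + 2)) / Λ := by gcongr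
    have e1 := mul_le_mul_of_nonneg_left hb (gap_pos (k + 1)).le
    have e2 := mul_le_mul_of_nonneg_left hl' (freq_pos (k + 1)).le
    have e3 : freq (k + 1) * ((log (k + 2) - 1 / (k + 2)) / Λ) =
        freq (k + 1) * (log (k + 2) / Λ) - (k + 2) / Λ := by
      unfold freq
      push_cast
      field_simp
      ring
    have e4 : (((k : ℝ) + 2) ^ 2 - 1) / (2 * Λ) = (((k : ℝ) + 1) ^ 2 - 1) / (2 * Λ) +
        (k + 2) / Λ - 1 / (2 * Λ) := by
      field_simp
      ring
    have e5 : 0 < 1 / (2 * Λ) := by positivity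
    rw [freq_succ (k + 1)]
    push_cast
    rw [show (k : ℝ) + 1 + 1 = k + 2 by ring]
    linarith

lemma norm_block_le (hΛ : 0 < Λ) (hk : 1 ≤ k) (h1 : k ≤ exp (Λ * w.re))
    (h2 : exp (Λ * w.re) ≤ k + 1) :
    ‖block Λ k w‖ ≤ (1 + exp (5 / Λ)) * exp (-freq k * w.re) := by
  refine (norm_sub_le _ _).trans ?_
  rw [norm_waveIn, norm_waveOut, add_mul]
  refine add_le_add ?_ ?_
  · gcongr
    linarith [step_nonneg (Λ := Λ) (k := k) (i := 4) (s := w.re)]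
  · exact (mul_le_of_le_one_left (exp_pos _).le step_le_one).trans (exp_logAmp_le hΛ hk h1 h2)

lemma exists_norm_profile_le (hΛ : 0 < Λ) : ∃ C : ℝ, ∀ w : ℂ, 1 ≤ exp (Λ * w.re) →
    ‖profile Λ w‖ ≤ C * exp (-(1 / (8 * Λ)) * exp (Λ * w.re) ^ 2) := by
  refine ⟨(1 + exp (5 / Λ)) * exp (1 / (2 * Λ)), fun w hw => ?_⟩
  obtain ⟨k, hk, h1, h2⟩ := exists_floor_eq_succ hw
  have hk0 : (0 : ℝ) ≤ k := by positivity
  rw [profile_eq_coef_mul hk, norm_mul, Complex.norm_real, norm_eq_abs]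
  have hs : log (k + 1) / Λ ≤ w.re := by
    rw [div_le_iff₀' hΛ, log_le_iff_le_exp (by positivity)]
    exact_mod_cast h1
  calc _ ≤ exp (freq (k + 1) * (log (k + 1) / Λ) - (((k : ℝ) + 1) ^ 2 - 1) / (2 * Λ)) *
        ((1 + exp (5 / Λ)) * exp (-freq (k + 1) * (log (k + 1) / Λ))) := by
        refine mul_le_mul (abs_coef_le hΛ) ((norm_block_le hΛ (by omega) h1 h2.le).trans ?_)
          (norm_nonneg _) (exp_pos _).le
        have := mul_le_mul_of_nonneg_left hs (freq_pos (k + 1)).le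
        gcongr ?_ * exp ?_
        linarith
    _ = (1 + exp (5 / Λ)) * (exp (1 / (2 * Λ)) * exp (-(((k : ℝ) + 1) ^ 2 / (2 * Λ)))) := by
        rw [mul_left_comm, ← exp_add, ← exp_add]
        ring_nf
    _ ≤ _ := by
        rw [← mul_assoc]
        gcongr
        rw [neg_mul, neg_le_neg_iff]
        have : exp (Λ * w.re) ≤ 2 * (k + 1) := by push_cast at h2; linarith
        calc 1 / (8 * Λ) * exp (Λ * w.re) ^ 2 ≤ 1 / (8 * Λ) * (2 * (k + 1)) ^ 2 := by gcongr
          _ = _ := by field_simp; ring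

end

lemma lap_pow_four (w : ℂ) : lap (fun z => z ^ 4) w = 0 := by
  have hf : ContDiff ℝ 2 fun z : ℂ => z ^ 4 := by fun_prop
  have h : ∀ v : ℂ, fderiv ℝ (fderiv ℝ fun z : ℂ => z ^ 4) w v v = 12 * w ^ 2 * v ^ 2 := by
    intro v
    have hl : ∀ t : ℝ, HasDerivAt (fun t : ℝ => w + t * v) v t := fun t => by
      simpa using ((Complex.ofRealCLM.hasDerivAt (x := t)).mul_const v).const_add w
    refine fderiv_fderiv_apply_eq (f' := fun z => 4 * z ^ 3 * v) hf (fun t => ?_) ?_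
    · simpa using (hl t).fun_pow 4
    · refine ((((hl 0).fun_pow 3).const_mul 4).mul_const v).congr_deriv ?_
      simp
      ring
  unfold lap
  rw [h, h, Complex.I_sq]
  ring

lemma continuous_lap {f : ℂ → ℂ} (hf : ContDiff ℝ 2 f) : Continuous (lap f) := by
  have h : Continuous (fderiv ℝ (fderiv ℝ f)) :=
    (hf.fderiv_right (m := 1) (by norm_num)).continuous_fderiv (by norm_num)
  unfold lap
  fun_prop

section

variable {Λ : ℝ} {z : ℂ}

/-- The solution on the complex plane. -/
noncomputable def solution (Λ : ℝ) (z : ℂ) : ℂ := if z = 0 then 0 else profile Λ (Complex.log z)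

lemma solution_of_ne_zero (hz : z ≠ 0) : solution Λ z = profile Λ (Complex.log z) := if_neg hz

lemma solution_exp (w : ℂ) : solution Λ (Complex.exp w) = profile Λ w := by
  obtain ⟨n, hn⟩ := Complex.exp_eq_exp_iff_exists_int.1 (Complex.exp_log (Complex.exp_ne_zero w))
  rw [solution_of_ne_zero (Complex.exp_ne_zero w), hn, profile_periodic.int_mul n]

lemma exp_mul_log_re (hz : z ≠ 0) : exp (Λ * (Complex.log z).re) = ‖z‖ ^ Λ := by
  rw [Complex.log_re, rpow_def_of_pos (norm_pos_iff.2 hz), mul_comm]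

lemma solution_eventuallyEq_pow (hΛ : 0 < Λ) : solution Λ =ᶠ[nhds 0] fun z => z ^ 4 := by
  have hc : ContinuousAt (fun z : ℂ => ‖z‖ ^ Λ) 0 :=
    continuous_norm.continuousAt.rpow_const (Or.inr hΛ.le)
  have h0 : ‖(0 : ℂ)‖ ^ Λ < 5 / 8 := by rw [norm_zero, zero_rpow hΛ.ne']; norm_num
  filter_upwards [hc.eventually (gt_mem_nhds h0)] with z hz
  by_cases h : z = 0
  · simp [solution, h]
  · rw [solution_of_ne_zero h, profile_eq_of_le (by rw [exp_mul_log_re h]; exact hz.le)]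
    exact (Complex.exp_nat_mul _ 4).trans (by rw [Complex.exp_log h])

lemma contDiff_solution (hΛ : 0 < Λ) : ContDiff ℝ 2 (solution Λ) := by
  refine contDiff_iff_contDiffAt.2 fun z₀ => ?_
  by_cases h : z₀ = 0
  · subst h
    exact ContDiffAt.congr_of_eventuallyEq (by fun_prop) (solution_eventuallyEq_pow hΛ)
  · have hl : ContDiffAt ℝ 2 (fun z => Complex.log (z / z₀) + Complex.log z₀) z₀ := by
      have h1 : ContDiffAt ℝ 2 Complex.log (z₀ / z₀) :=
        (Complex.contDiffAt_log (by simp [h])).restrict_scalars ℝ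
      have h2 : ContDiffAt ℝ 2 (fun z : ℂ => z / z₀) z₀ := by fun_prop
      exact (h1.comp (f := fun z => z / z₀) z₀ h2).add contDiffAt_const
    refine ((contDiff_profile (Λ := Λ)).contDiffAt.comp z₀ hl).congr_of_eventuallyEq ?_
    filter_upwards [isOpen_ne.mem_nhds h] with z hz
    rw [Function.comp_apply, ← solution_exp, Complex.exp_add, Complex.exp_log h,
      Complex.exp_log (div_ne_zero hz h), div_mul_cancel₀ _ h]

lemma lap_profile_log (hΛ : 0 < Λ) (hz : z ≠ 0) :
    lap (profile Λ) (Complex.log z) = (‖z‖ : ℂ) ^ 2 * lap (solution Λ) z := by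
  have := lap_comp_exp (w := Complex.log z) (contDiff_solution hΛ).contDiffAt
  simpa only [solution_exp, Complex.exp_log hz] using this

lemma solution_ne_zero_or_lap_eq_zero (hΛ : 0 < Λ) (z₀ : ℂ) :
    solution Λ z₀ ≠ 0 ∨ ∀ᶠ z in nhds z₀, lap (solution Λ) z = 0 := by
  by_cases h : z₀ = 0
  · right
    subst h
    filter_upwards [(solution_eventuallyEq_pow hΛ).eventuallyEq_nhds] with z hz
    rw [lap_congr hz, lap_pow_four]
  · rw [solution_of_ne_zero h]
    refine (profile_ne_zero_or_lap_eq_zero hΛ (Complex.log z₀)).imp_right fun h0 => ?_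
    have hm : Filter.map Complex.exp (nhds (Complex.log z₀)) = nhds z₀ := by
      rw [(Complex.hasStrictDerivAt_exp _).map_nhds_eq (Complex.exp_ne_zero _), Complex.exp_log h]
    rw [← hm, Filter.eventually_map]
    filter_upwards [h0] with w hw
    have := lap_comp_exp (w := w) (contDiff_solution hΛ).contDiffAt
    simp only [solution_exp] at this
    rw [hw] at this
    exact (mul_eq_zero.1 this.symm).resolve_left (by simp)

/-- The potential on the complex plane. -/
noncomputable def potential (Λ : ℝ) (z : ℂ) : ℂ := lap (solution Λ) z / solution Λ z

lemma continuous_potential (hΛ : 0 < Λ) : Continuous (potential Λ) := by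
  refine continuous_iff_continuousAt.2 fun z₀ => ?_
  rcases solution_ne_zero_or_lap_eq_zero hΛ z₀ with h | h
  · exact (continuous_lap (contDiff_solution hΛ)).continuousAt.div
      (contDiff_solution hΛ).continuous.continuousAt h
  · refine continuousAt_const (y := (0 : ℂ)).congr ?_
    filter_upwards [h] with z hz
    rw [potential, hz, zero_div]

lemma potential_mul_solution (hΛ : 0 < Λ) (z : ℂ) :
    potential Λ z * solution Λ z = lap (solution Λ) z := by
  rcases solution_ne_zero_or_lap_eq_zero hΛ z with h | h
  · exact div_mul_cancel₀ _ h
  · rw [potential, h.self_of_nhds, zero_div, zero_mul]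

lemma one_le_rpow_norm (hΛ : 0 < Λ) (hz : 1 ≤ ‖z‖) :
    z ≠ 0 ∧ 1 ≤ exp (Λ * (Complex.log z).re) := by
  have h : z ≠ 0 := norm_pos_iff.1 (one_pos.trans_le hz)
  exact ⟨h, by rw [exp_mul_log_re h]; exact one_le_rpow hz hΛ.le⟩

lemma exists_norm_potential_le (hΛ : 0 < Λ) : ∃ C : ℝ, ∀ z : ℂ, 1 ≤ ‖z‖ →
    ‖potential Λ z‖ ≤ C * ‖z‖ ^ (3 * Λ - 2) := by
  obtain ⟨C, hC⟩ := exists_norm_lap_profile_le hΛ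
  refine ⟨|C|, fun z hz => ?_⟩
  obtain ⟨h0, h1⟩ := one_le_rpow_norm hΛ hz
  have hz0 : 0 < ‖z‖ := norm_pos_iff.2 h0
  have h := hC _ h1
  rw [lap_profile_log hΛ h0, exp_mul_log_re h0, ← solution_of_ne_zero h0, norm_mul, norm_pow,
    Complex.norm_real, norm_norm] at h
  rw [potential, norm_div]
  refine div_le_of_le_mul₀ (norm_nonneg _) (by positivity) ?_
  have e : ‖z‖ ^ (3 * Λ - 2) = (‖z‖ ^ Λ) ^ 3 / ‖z‖ ^ 2 := by
    rw [rpow_sub hz0, ← rpow_natCast (‖z‖ ^ Λ), ← rpow_mul hz0.le, mul_comm Λ]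
    norm_num
  rw [e, mul_div_assoc', div_mul_eq_mul_div, le_div_iff₀' (by positivity)]
  refine h.trans ?_
  gcongr
  exact le_abs_self C

lemma exists_norm_solution_le (hΛ : 0 < Λ) : ∃ C : ℝ, ∀ z : ℂ, 1 ≤ ‖z‖ →
    ‖solution Λ z‖ ≤ C * exp (-(1 / (8 * Λ)) * ‖z‖ ^ (2 * Λ)) := by
  obtain ⟨C, hC⟩ := exists_norm_profile_le hΛ
  refine ⟨C, fun z hz => ?_⟩
  obtain ⟨h0, h1⟩ := one_le_rpow_norm hΛ hz
  have h := hC _ h1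
  rwa [exp_mul_log_re h0, ← solution_of_ne_zero h0, ← rpow_natCast, ← rpow_mul (norm_nonneg _),
    mul_comm Λ, Nat.cast_ofNat] at h

lemma exists_solution_ne_zero (hΛ : 0 < Λ) (R : ℝ) : ∃ z : ℂ, R < ‖z‖ ∧ solution Λ z ≠ 0 := by
  obtain ⟨k, hk⟩ := exists_nat_gt (exp (Λ * R))
  refine ⟨Complex.exp (log (k + 1) / Λ : ℝ), ?_, ?_⟩
  · rw [Complex.norm_exp, Complex.ofReal_re]
    refine lt_of_lt_of_le ?_ ((lt_add_one _).le.trans (add_one_le_exp _))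
    rw [lt_div_iff₀' hΛ, lt_log_iff_exp_lt (by positivity)]
    linarith
  · rw [solution_exp]
    refine profile_ne_zero (k := k) ?_
    rw [Complex.ofReal_re, mul_div_cancel₀ _ hΛ.ne', exp_log (by positivity)]

end

end Meshkov

open Meshkov in
/-- **Cruz-Sampedro's generalization of Meshkov's counterexample** (Theorem 2 of
Cruz-Sampedro, 1999). If `ε < 1/2`, `δ > 0` and `2ε + 3δ = 1`, there exist a continuous
complex potential `q` with `q(x) = O(|x|^{−ε})` and a `C²` function `u` without compact
support satisfying `Δu − q u = 0` on `ℝ²` and `u(x) = O(exp(−β|x|^{1+δ}))` for some `β > 0`. -/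
theorem cruzSampedro_counterexample (ε δ : ℝ) (hε : ε < 1 / 2) (hδ : 0 < δ)
    (h : 2 * ε + 3 * δ = 1) :
    ∃ q u : EuclideanSpace ℝ (Fin 2) → ℂ,
      Continuous q ∧
      (∃ C R : ℝ, ∀ x, R ≤ ‖x‖ → ‖q x‖ ≤ C * ‖x‖ ^ (-ε)) ∧
      ContDiff ℝ 2 u ∧
      ¬ HasCompactSupport u ∧
      (∀ x, laplacian u x - q x * u x = 0) ∧
      (∃ β : ℝ, 0 < β ∧ ∃ C R : ℝ, ∀ x, R ≤ ‖x‖ →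
        ‖u x‖ ≤ C * Real.exp (-β * ‖x‖ ^ (1 + δ))) := by
  have hΛ : 0 < (1 + δ) / 2 := by linarith
  set Λ := (1 + δ) / 2 with hΛdef
  set J := Complex.orthonormalBasisOneI.repr.symm with hJ
  have hq : 3 * Λ - 2 = -ε := by linarith
  have hu : 2 * Λ = 1 + δ := by linarith
  refine ⟨fun x => potential Λ (J x), fun x => solution Λ (J x),
    (continuous_potential hΛ).comp J.continuous, ?_,
    (contDiff_solution hΛ).comp J.toContinuousLinearEquiv.contDiff, ?_, fun x => ?_,
    1 / (8 * Λ), by positivity, ?_⟩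
  · obtain ⟨C, hC⟩ := exists_norm_potential_le hΛ
    refine ⟨C, 1, fun x hx => ?_⟩
    rw [← hq, ← J.norm_map]
    exact hC _ (by rwa [J.norm_map])
  · intro hc
    obtain ⟨R, hR⟩ := hc.isCompact.isBounded.exists_norm_le
    obtain ⟨z, hz, h0⟩ := exists_solution_ne_zero hΛ R
    have := hR (J.symm z) (subset_tsupport _ (by simpa using h0))
    rw [J.symm.norm_map] at this
    exact this.not_gt hz
  · rw [laplacian_comp_repr (contDiff_solution hΛ).contDiffAt, potential_mul_solution hΛ, sub_self]
  · obtain ⟨C, hC⟩ := exists_norm_solution_le hΛ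
    refine ⟨C, 1, fun x hx => ?_⟩
    rw [← hu, ← J.norm_map]
    exact hC _ (by rwa [J.norm_map])
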